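/- Assume g is C³ and satisfies (A1), (A2). Let A > 0, E > 0, and let ψ_n be classical solutions of the equivariant wave map equation (WM) on [−A,A] × (0,∞) such that: (1) E(ψ⃗_n(t)) ≤ E for all n and t; (2) the sequence of limits ψ_n(0) (values at r = 0) is bounded; (3) for some sequence r_n → +∞, ∫_{−A}^{A} ∫₀^{r_n} |∂ₜψ_n(t,r)|² r dr dt → 0 as n → ∞. Then there exist a subsequence ψ_{σ(n)} and a harmonic map Q (possibly constant) such that for every R > 0, sup_{t∈[−A,A]} ‖ψ⃗_{σ(n)}(t) − (Q,0)‖_{H×L²([1/R,R])} → 0 as n → ∞. -/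

import Mathlib

open MeasureTheory Filter Topology Set
open scoped ENNReal

noncomputable section

/-- `G(x) = ∫₀ˣ |g(y)| dy`. -/
def Gfun (g : ℝ → ℝ) (x : ℝ) : ℝ := ∫ y in (0:ℝ)..x, |g y|

/-- Assumption (A1): `G(x) → ±∞` as `x → ±∞`. -/
def A1 (g : ℝ → ℝ) : Prop := Tendsto (Gfun g) atTop atTop ∧ Tendsto (Gfun g) atBot atBot

/-- Assumption (A2): the zero set `𝒱` of `g` is discrete. -/
def A2 (g : ℝ → ℝ) : Prop :=
  ∀ ℓ : ℝ, g ℓ = 0 → ∃ ε > 0, ∀ x : ℝ, g x = 0 → |x - ℓ| < ε → x = ℓ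

/-- Assumption (A3): `g'(ℓ) ∈ {−1,1}` for every zero `ℓ` of `g`. -/
def A3 (g : ℝ → ℝ) : Prop := ∀ ℓ : ℝ, g ℓ = 0 → deriv g ℓ = 1 ∨ deriv g ℓ = -1

/-- Time derivative `∂ₜψ(t,r)`. -/
def pdt (ψ : ℝ → ℝ → ℝ) (t r : ℝ) : ℝ := deriv (fun s => ψ s r) t
/-- Radial derivative `∂ᵣψ(t,r)`. -/
def pdr (ψ : ℝ → ℝ → ℝ) (t r : ℝ) : ℝ := deriv (fun ρ => ψ t ρ) r
/-- Second time derivative `∂ₜₜψ(t,r)`. -/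
def pdtt (ψ : ℝ → ℝ → ℝ) (t r : ℝ) : ℝ := deriv (fun s => pdt ψ s r) t
/-- Second radial derivative `∂ᵣᵣψ(t,r)`. -/
def pdrr (ψ : ℝ → ℝ → ℝ) (t r : ℝ) : ℝ := deriv (fun ρ => pdr ψ t ρ) r

/-- Energy of a pair `(φ₀, φ₁)` on a set `s ⊆ (0,∞)` of radii:
`∫_s (φ₁² + (∂ᵣφ₀)² + g(φ₀)²/r²) r dr`. -/
def energyOn (g : ℝ → ℝ) (φ₀ φ₁ : ℝ → ℝ) (s : Set ℝ) : ℝ≥0∞ :=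
  ∫⁻ r in s, ENNReal.ofReal (((φ₁ r)^2 + (deriv φ₀ r)^2 + (g (φ₀ r))^2 / r^2) * r)

/-- Squared `H × L²` norm of a pair `(φ₀, φ₁)` on a set `s ⊆ (0,∞)` of radii:
`∫_s (φ₁² + (∂ᵣφ₀)² + φ₀²/r²) r dr`. -/
def HLnormSqOn (φ₀ φ₁ : ℝ → ℝ) (s : Set ℝ) : ℝ≥0∞ :=
  ∫⁻ r in s, ENNReal.ofReal (((φ₁ r)^2 + (deriv φ₀ r)^2 + (φ₀ r)^2 / r^2) * r)

/-- Squared `H` norm of a single function on a set `s ⊆ (0,∞)` of radii. -/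
def HnormSqOn (φ : ℝ → ℝ) (s : Set ℝ) : ℝ≥0∞ :=
  ∫⁻ r in s, ENNReal.ofReal (((deriv φ r)^2 + (φ r)^2 / r^2) * r)

/-- `ψ` is a classical solution of the equivariant wave map equation (WM) on `I × (0,∞)`. -/
def IsWaveMapOn (g : ℝ → ℝ) (ψ : ℝ → ℝ → ℝ) (I : Set ℝ) : Prop :=
  ContDiffOn ℝ 2 (fun p : ℝ × ℝ => ψ p.1 p.2) (I ×ˢ Ioi (0:ℝ)) ∧
  ∀ t ∈ I, ∀ r ∈ Ioi (0:ℝ),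
    pdtt ψ t r - pdrr ψ t r - pdr ψ t r / r + g (ψ t r) * deriv g (ψ t r) / r^2 = 0

/-- `φ` is a classical solution of the linearized equation (LW) with coefficient `k²` on
`I × (0,∞)`. -/
def IsLinWaveOn (k : ℝ) (φ : ℝ → ℝ → ℝ) (I : Set ℝ) : Prop :=
  ContDiffOn ℝ 2 (fun p : ℝ × ℝ => φ p.1 p.2) (I ×ˢ Ioi (0:ℝ)) ∧
  ∀ t ∈ I, ∀ r ∈ Ioi (0:ℝ),
    pdtt φ t r - pdrr φ t r - pdr φ t r / r + k^2 * φ t r / r^2 = 0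

/-- A finite-energy classical solution of the linearized equation (LW), defined for all times. -/
def IsFiniteEnergyLinWave (k : ℝ) (φ : ℝ → ℝ → ℝ) : Prop :=
  IsLinWaveOn k φ univ ∧ ∃ C : ℝ≥0∞, C < ⊤ ∧ ∀ t : ℝ, HLnormSqOn (φ t) (pdt φ t) (Ioi 0) ≤ C

/-- A (possibly constant) harmonic map: a finite-energy `C²` solution of
`Q'' + Q'/r = f(Q)/r²` on `(0,∞)`, together with its limits at `r = 0` and `r = ∞`,
which belong to the zero set `𝒱` of `g`. -/
structure HarmonicMap (g : ℝ → ℝ) where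
  Q : ℝ → ℝ
  Q0 : ℝ
  Qinf : ℝ
  smooth : ContDiffOn ℝ 2 Q (Ioi 0)
  eqn : ∀ r ∈ Ioi (0:ℝ), deriv (deriv Q) r + deriv Q r / r = g (Q r) * deriv g (Q r) / r^2
  finiteEnergy : energyOn g Q (fun _ => 0) (Ioi 0) < ⊤
  lim_zero : Tendsto Q (𝓝[>] (0:ℝ)) (𝓝 Q0)
  lim_infty : Tendsto Q atTop (𝓝 Qinf)
  zero_mem : g Q0 = 0
  infty_mem : g Qinf = 0

/-- The interval `[r₁, r₂] ∩ (0,∞)`, where `r₂` may be `+∞` (an extended real). -/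
def sIcc (r₁ : ℝ) (r₂ : EReal) : Set ℝ := {r : ℝ | r₁ ≤ r ∧ (r : EReal) ≤ r₂} ∩ Ioi 0

/-- The open interval `(r₁, r₂)`, where `r₂` may be `+∞` (an extended real). -/
def sIoo (r₁ : ℝ) (r₂ : EReal) : Set ℝ := {r : ℝ | r₁ < r ∧ (r : EReal) < r₂}

/-- The filter of approach to the (possibly infinite) point `b` within the set `s ⊆ ℝ`. -/
def approach (s : Set ℝ) (b : EReal) : Filter ℝ :=
  Filter.comap (fun r : ℝ => (r : EReal)) (𝓝 b) ⊓ Filter.principal s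

end

/-- Differentiation under the integral sign over a compact interval. -/
lemma hasDerivAt_integral_param {u u' : ℝ → ℝ → ℝ} {U : Set ℝ} (hU : IsOpen U) {a b : ℝ}
    (hd : ∀ x ∈ U, ∀ y ∈ uIcc a b, HasDerivAt (fun x => u x y) (u' x y) x)
    (hc : ∀ x ∈ U, ContinuousOn (u x) (uIcc a b))
    (hc' : ContinuousOn (fun p : ℝ × ℝ => u' p.1 p.2) (U ×ˢ uIcc a b))
    {x₀ : ℝ} (hx₀ : x₀ ∈ U) :
    HasDerivAt (fun x => ∫ y in a..b, u x y) (∫ y in a..b, u' x₀ y) x₀ := by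
  obtain ⟨ε, hε, hball⟩ := Metric.nhds_basis_closedBall.mem_iff.1 (hU.mem_nhds hx₀)
  have hcomp : IsCompact (Metric.closedBall x₀ ε ×ˢ uIcc a b) :=
    (isCompact_closedBall x₀ ε).prod isCompact_uIcc
  obtain ⟨C, hC⟩ := hcomp.exists_bound_of_continuousOn (hc'.mono (prod_mono hball Subset.rfl))
  have hslice : ContinuousOn (u' x₀) (uIcc a b) :=
    hc'.comp (f := fun y => (x₀, y)) (by fun_prop) (fun y hy => ⟨hx₀, hy⟩)
  refine (intervalIntegral.hasDerivAt_integral_of_dominated_loc_of_deriv_le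
    (bound := fun _ => C) (Metric.closedBall_mem_nhds x₀ hε) ?_ ?_ ?_ ?_ ?_ ?_).2
  · filter_upwards [hU.mem_nhds hx₀] with x hx
    exact ((hc x hx).mono uIoc_subset_uIcc).aestronglyMeasurable measurableSet_uIoc
  · exact (hc x₀ hx₀).intervalIntegrable
  · exact (hslice.mono uIoc_subset_uIcc).aestronglyMeasurable measurableSet_uIoc
  · exact Eventually.of_forall fun t ht x hx => hC (x, t) ⟨hx, uIoc_subset_uIcc ht⟩
  · exact intervalIntegrable_const
  · exact Eventually.of_forall fun t ht x hx => hd x (hball hx) t (uIoc_subset_uIcc ht)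

/-- Joint continuity on the open space-time slab `(-A, A) × (0, ∞)`. -/
def SlabCont (A : ℝ) (u : ℝ → ℝ → ℝ) : Prop :=
  ContinuousOn (fun p : ℝ × ℝ => u p.1 p.2) (Ioo (-A) A ×ˢ Ioi 0)

/-- A `C²` function on the slab `(-A, A) × (0, ∞)` together with its partial derivatives. -/
structure SlabC2 (A : ℝ) (w wt wr wtt wtr wrr : ℝ → ℝ → ℝ) : Prop where
  dt : ∀ t ∈ Ioo (-A) A, ∀ r, 0 < r → HasDerivAt (fun s => w s r) (wt t r) t
  dr : ∀ t ∈ Ioo (-A) A, ∀ r, 0 < r → HasDerivAt (fun ρ => w t ρ) (wr t r) r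
  dtt : ∀ t ∈ Ioo (-A) A, ∀ r, 0 < r → HasDerivAt (fun s => wt s r) (wtt t r) t
  dtr : ∀ t ∈ Ioo (-A) A, ∀ r, 0 < r → HasDerivAt (fun s => wr s r) (wtr t r) t
  drt : ∀ t ∈ Ioo (-A) A, ∀ r, 0 < r → HasDerivAt (fun ρ => wt t ρ) (wtr t r) r
  drr : ∀ t ∈ Ioo (-A) A, ∀ r, 0 < r → HasDerivAt (fun ρ => wr t ρ) (wrr t r) r
  c : SlabCont A w
  ct : SlabCont A wt
  cr : SlabCont A wr
  ctt : SlabCont A wtt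
  ctr : SlabCont A wtr
  crr : SlabCont A wrr

lemma SlabCont.slice {A : ℝ} {u : ℝ → ℝ → ℝ} (h : SlabCont A u) {t : ℝ} (ht : t ∈ Ioo (-A) A) :
    ContinuousOn (u t) (Ioi 0) :=
  ContinuousOn.comp (f := fun y => (t, y)) h (by fun_prop) (fun _ hy => ⟨ht, hy⟩)

lemma SlabCont.slice_time {A : ℝ} {u : ℝ → ℝ → ℝ} (h : SlabCont A u) {r : ℝ} (hr : 0 < r) :
    ContinuousOn (fun t => u t r) (Ioo (-A) A) :=
  ContinuousOn.comp (f := fun y => (y, r)) h (by fun_prop) (fun _ hy => ⟨hy, hr⟩)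

lemma uIcc_subset_Ioi_zero {a b : ℝ} (ha : 0 < a) (hb : 0 < b) : uIcc a b ⊆ Ioi 0 :=
  fun _ hx => (lt_min ha hb).trans_le hx.1

lemma SlabCont.hasDerivAt_integral_time {A : ℝ} {u ut : ℝ → ℝ → ℝ} (hu : SlabCont A u)
    (hut : SlabCont A ut)
    (hd : ∀ t ∈ Ioo (-A) A, ∀ r, 0 < r → HasDerivAt (fun s => u s r) (ut t r) t)
    {a b : ℝ} (ha : 0 < a) (hb : 0 < b) {t : ℝ} (ht : t ∈ Ioo (-A) A) :
    HasDerivAt (fun t => ∫ r in a..b, u t r) (∫ r in a..b, ut t r) t :=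
  hasDerivAt_integral_param isOpen_Ioo
    (fun x hx y hy => hd x hx y (uIcc_subset_Ioi_zero ha hb hy))
    (fun _ hx => (hu.slice hx).mono (uIcc_subset_Ioi_zero ha hb))
    (hut.mono (prod_mono Subset.rfl (uIcc_subset_Ioi_zero ha hb))) ht

lemma SlabCont.hasDerivAt_integral_space {A : ℝ} {u ur : ℝ → ℝ → ℝ} (hu : SlabCont A u)
    (hur : SlabCont A ur)
    (hd : ∀ t ∈ Ioo (-A) A, ∀ r, 0 < r → HasDerivAt (fun s => u t s) (ur t r) r)
    {c d : ℝ} (hcd : uIcc c d ⊆ Ioo (-A) A) {r : ℝ} (hr : 0 < r) :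
    HasDerivAt (fun r => ∫ t in c..d, u t r) (∫ t in c..d, ur t r) r :=
  hasDerivAt_integral_param (u := fun r t => u t r) (u' := fun r t => ur t r) isOpen_Ioi
    (fun x hx y hy => hd y (hcd hy) x hx)
    (fun _ hx => (hu.slice_time hx).mono hcd)
    (ContinuousOn.comp (f := fun p : ℝ × ℝ => (p.2, p.1)) hur (by fun_prop)
      (fun p hp => ⟨hcd hp.2, hp.1⟩)) hr

/-- The partial derivatives of a `C²` function form a `SlabC2`. -/
lemma SlabC2.of_contDiffOn {A : ℝ} {ψ : ℝ → ℝ → ℝ}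
    (h : ContDiffOn ℝ 2 (fun p : ℝ × ℝ => ψ p.1 p.2) (Icc (-A) A ×ˢ Ioi (0:ℝ))) :
    ∃ m, SlabC2 A ψ (pdt ψ) (pdr ψ) (pdtt ψ) m (pdrr ψ) := by
  set Ψ : ℝ × ℝ → ℝ := fun p => ψ p.1 p.2 with hΨ
  set O : Set (ℝ × ℝ) := Ioo (-A) A ×ˢ Ioi 0 with hO
  have hOo : IsOpen O := isOpen_Ioo.prod isOpen_Ioi
  have h2 : ContDiffOn ℝ 2 Ψ O := h.mono (prod_mono Ioo_subset_Icc_self Subset.rfl)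
  have hD : ContDiffOn ℝ 1 (fderiv ℝ Ψ) O := h2.fderiv_of_isOpen hOo (by norm_num)
  have hDD : ContinuousOn (fderiv ℝ (fderiv ℝ Ψ)) O :=
    hD.continuousOn_fderiv_of_isOpen hOo (by norm_num)
  have hΨd : ∀ p ∈ O, HasFDerivAt Ψ (fderiv ℝ Ψ p) p := fun p hp =>
    ((h2.contDiffAt (hOo.mem_nhds hp)).differentiableAt (by norm_num)).hasFDerivAt
  have hDd : ∀ p ∈ O, HasFDerivAt (fderiv ℝ Ψ) (fderiv ℝ (fderiv ℝ Ψ) p) p := fun p hp =>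
    ((hD.contDiffAt (hOo.mem_nhds hp)).differentiableAt (by norm_num)).hasFDerivAt
  have hlt : ∀ t r : ℝ, HasDerivAt (fun s : ℝ => ((s, r) : ℝ × ℝ)) (1, 0) t := fun t r =>
    (hasDerivAt_id t).prodMk (hasDerivAt_const t r)
  have hlr : ∀ t r : ℝ, HasDerivAt (fun s : ℝ => ((t, s) : ℝ × ℝ)) (0, 1) r := fun t r =>
    (hasDerivAt_const r t).prodMk (hasDerivAt_id r)
  have hdt : ∀ t ∈ Ioo (-A) A, ∀ r, 0 < r →
      HasDerivAt (fun s => ψ s r) (fderiv ℝ Ψ (t, r) (1, 0)) t := fun t ht r hr =>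
    (hΨd (t, r) ⟨ht, hr⟩).comp_hasDerivAt (f := fun s : ℝ => (s, r)) t (hlt t r)
  have hdr : ∀ t ∈ Ioo (-A) A, ∀ r, 0 < r →
      HasDerivAt (fun s => ψ t s) (fderiv ℝ Ψ (t, r) (0, 1)) r := fun t ht r hr =>
    (hΨd (t, r) ⟨ht, hr⟩).comp_hasDerivAt (f := fun s : ℝ => (t, s)) r (hlr t r)
  have hpt : ∀ t ∈ Ioo (-A) A, ∀ r, 0 < r → pdt ψ t r = fderiv ℝ Ψ (t, r) (1, 0) :=
    fun t ht r hr => (hdt t ht r hr).deriv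
  have hpr : ∀ t ∈ Ioo (-A) A, ∀ r, 0 < r → pdr ψ t r = fderiv ℝ Ψ (t, r) (0, 1) :=
    fun t ht r hr => (hdr t ht r hr).deriv
  have hDv : ∀ v : ℝ × ℝ, ∀ p ∈ O, HasFDerivAt (fun q => fderiv ℝ Ψ q v)
      ((ContinuousLinearMap.apply ℝ ℝ v).comp (fderiv ℝ (fderiv ℝ Ψ) p)) p := fun v p hp =>
    (ContinuousLinearMap.apply ℝ ℝ v).hasFDerivAt.comp p (hDd p hp)
  have h2t : ∀ v : ℝ × ℝ, ∀ t ∈ Ioo (-A) A, ∀ r, 0 < r →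
      HasDerivAt (fun s => fderiv ℝ Ψ (s, r) v) (fderiv ℝ (fderiv ℝ Ψ) (t, r) (1, 0) v) t :=
    fun v t ht r hr => (hDv v (t, r) ⟨ht, hr⟩).comp_hasDerivAt (f := fun s : ℝ => (s, r)) t
      (hlt t r)
  have h2r : ∀ v : ℝ × ℝ, ∀ t ∈ Ioo (-A) A, ∀ r, 0 < r →
      HasDerivAt (fun s => fderiv ℝ Ψ (t, s) v) (fderiv ℝ (fderiv ℝ Ψ) (t, r) (0, 1) v) r :=
    fun v t ht r hr => (hDv v (t, r) ⟨ht, hr⟩).comp_hasDerivAt (f := fun s : ℝ => (t, s)) r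
      (hlr t r)
  have evt : ∀ t ∈ Ioo (-A) A, ∀ᶠ s in 𝓝 t, s ∈ Ioo (-A) A := fun t ht => isOpen_Ioo.mem_nhds ht
  have evr : ∀ r : ℝ, 0 < r → ∀ᶠ s in 𝓝 r, 0 < s := fun r hr => isOpen_Ioi.mem_nhds hr
  have htt : ∀ t ∈ Ioo (-A) A, ∀ r, 0 < r →
      HasDerivAt (fun s => pdt ψ s r) (fderiv ℝ (fderiv ℝ Ψ) (t, r) (1, 0) (1, 0)) t :=
    fun t ht r hr => (h2t (1, 0) t ht r hr).congr_of_eventuallyEq <| by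
      filter_upwards [evt t ht] with s hs using hpt s hs r hr
  have hrr : ∀ t ∈ Ioo (-A) A, ∀ r, 0 < r →
      HasDerivAt (fun s => pdr ψ t s) (fderiv ℝ (fderiv ℝ Ψ) (t, r) (0, 1) (0, 1)) r :=
    fun t ht r hr => (h2r (0, 1) t ht r hr).congr_of_eventuallyEq <| by
      filter_upwards [evr r hr] with s hs using hpr t ht s hs
  have htr : ∀ t ∈ Ioo (-A) A, ∀ r, 0 < r →
      HasDerivAt (fun s => pdr ψ s r) (fderiv ℝ (fderiv ℝ Ψ) (t, r) (1, 0) (0, 1)) t :=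
    fun t ht r hr => (h2t (0, 1) t ht r hr).congr_of_eventuallyEq <| by
      filter_upwards [evt t ht] with s hs using hpr s hs r hr
  have hrt : ∀ t ∈ Ioo (-A) A, ∀ r, 0 < r →
      HasDerivAt (fun s => pdt ψ t s) (fderiv ℝ (fderiv ℝ Ψ) (t, r) (0, 1) (1, 0)) r :=
    fun t ht r hr => (h2r (1, 0) t ht r hr).congr_of_eventuallyEq <| by
      filter_upwards [evr r hr] with s hs using hpt t ht s hs
  have hsymm : ∀ t ∈ Ioo (-A) A, ∀ r, 0 < r →
      fderiv ℝ (fderiv ℝ Ψ) (t, r) (0, 1) (1, 0) = fderiv ℝ (fderiv ℝ Ψ) (t, r) (1, 0) (0, 1) :=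
    fun t ht r hr => by
      have hp : (t, r) ∈ O := ⟨ht, hr⟩
      have := (h2.contDiffAt (hOo.mem_nhds hp)).isSymmSndFDerivAt (by simp)
      exact this _ _
  have cD : ∀ v, ContinuousOn (fun p => fderiv ℝ Ψ p v) O := fun v =>
    hD.continuousOn.clm_apply continuousOn_const
  have cDD : ∀ v v', ContinuousOn (fun p => fderiv ℝ (fderiv ℝ Ψ) p v v') O := fun v v' =>
    (hDD.clm_apply continuousOn_const).clm_apply continuousOn_const
  refine ⟨fun t r => fderiv ℝ (fderiv ℝ Ψ) (t, r) (1, 0) (0, 1), ?_⟩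
  refine ⟨fun t ht r hr => ?_, fun t ht r hr => ?_, fun t ht r hr => ?_, htr,
    fun t ht r hr => ?_, fun t ht r hr => ?_, h2.continuousOn,
    ?_, ?_, ?_, cDD _ _, ?_⟩
  · exact (hdt t ht r hr).differentiableAt.hasDerivAt
  · exact (hdr t ht r hr).differentiableAt.hasDerivAt
  · exact (htt t ht r hr).differentiableAt.hasDerivAt
  · rw [← hsymm t ht r hr]; exact hrt t ht r hr
  · exact (hrr t ht r hr).differentiableAt.hasDerivAt
  · exact (cD (1, 0)).congr fun p hp => hpt p.1 hp.1 p.2 hp.2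
  · exact (cD (0, 1)).congr fun p hp => hpr p.1 hp.1 p.2 hp.2
  · exact (cDD (1, 0) (1, 0)).congr fun p hp => (htt p.1 hp.1 p.2 hp.2).deriv
  · exact (cDD (0, 1) (0, 1)).congr fun p hp => (hrr p.1 hp.1 p.2 hp.2).deriv

/-- If `|u'| ≤ p'` on an interval, then increments of `u` are controlled by those of `p`. -/
lemma abs_sub_le_abs_sub_of_deriv_le {A : ℝ} {u u' p p' : ℝ → ℝ}
    (hu : ∀ t ∈ Ioo (-A) A, HasDerivAt u (u' t) t) (hp : ∀ t ∈ Ioo (-A) A, HasDerivAt p (p' t) t)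
    (hle : ∀ t ∈ Ioo (-A) A, |u' t| ≤ p' t) {s t : ℝ} (hs : s ∈ Ioo (-A) A)
    (ht : t ∈ Ioo (-A) A) : |u t - u s| ≤ |p t - p s| := by
  have key : ∀ v v' : ℝ → ℝ, (∀ t ∈ Ioo (-A) A, HasDerivAt v (v' t) t) →
      (∀ t ∈ Ioo (-A) A, 0 ≤ v' t) → MonotoneOn v (Ioo (-A) A) := by
    intro v v' hv h0
    refine monotoneOn_of_deriv_nonneg (convex_Ioo _ _)
      (fun t ht => (hv t ht).continuousAt.continuousWithinAt)
      (fun t ht => ?_) (fun t ht => ?_)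
    · rw [interior_Ioo] at ht
      exact (hv t ht).differentiableAt.differentiableWithinAt
    · rw [interior_Ioo] at ht
      rw [(hv t ht).deriv]; exact h0 t ht
  have h1 := key _ _ (fun t ht => (hp t ht).sub (hu t ht)) (fun t ht => by
    have := abs_le.1 (hle t ht); linarith [this.2])
  have h2 := key _ _ (fun t ht => (hp t ht).add (hu t ht)) (fun t ht => by
    have := abs_le.1 (hle t ht); linarith [this.1])
  rcases le_total s t with hst | hst
  · have a1 := h1 hs ht hst
    have a2 := h2 hs ht hst
    simp only [Pi.sub_apply, Pi.add_apply] at a1 a2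
    exact abs_le_abs_of_nonneg_sub a1 a2
  · have a1 := h1 ht hs hst
    have a2 := h2 ht hs hst
    simp only [Pi.sub_apply, Pi.add_apply] at a1 a2
    rw [abs_sub_comm, abs_sub_comm (p t)]
    exact abs_le_abs_of_nonneg_sub a1 a2
where
  abs_le_abs_of_nonneg_sub {a b c d : ℝ} (h1 : a - b ≤ c - d) (h2 : a + b ≤ c + d) :
      |d - b| ≤ |c - a| := by
    refine le_trans (abs_le.2 ⟨?_, ?_⟩) (le_abs_self _) <;> linarith

lemma energy_le_of_averaged_bounds {A C δ : ℝ} (hA : 0 < A) (hC : 0 ≤ C) (hδ : 0 < δ) (hδ1 : δ ≤ 1)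
    {e e' y y' k P : ℝ → ℝ}
    (he : ∀ t ∈ Ioo (-A) A, HasDerivAt e (e' t) t) (hy : ∀ t ∈ Ioo (-A) A, HasDerivAt y (y' t) t)
    (hP : ∀ t ∈ Ioo (-A) A, HasDerivAt P (k t) t)
    (he' : ∀ t ∈ Ioo (-A) A, |e' t| ≤ C * (δ + k t / δ))
    (hey : ∀ t ∈ Ioo (-A) A, e t ≤ C * k t - y' t + C * δ)
    (hyb : ∀ t ∈ Ioo (-A) A, |y t| ≤ C * δ) (hPb : ∀ t ∈ Ioo (-A) A, |P t| ≤ δ ^ 2)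
    {t : ℝ} (ht : t ∈ Ioo (-A) A) :
    e t ≤ C * ((4 + A) / A + 2 * A + 2) * δ := by
  have hosc : ∀ s ∈ Ioo (-A) A, e t - C * (2 * A + 2) * δ ≤ e s := by
    intro s hs
    have h := abs_sub_le_abs_sub_of_deriv_le (p := fun t => C * (δ * t + P t / δ)) he
      (fun t ht => (((hasDerivAt_id t).const_mul δ).add ((hP t ht).div_const δ)).const_mul C)
      (fun t ht => by simpa using he' t ht) hs ht
    have h1 : |C * (δ * t + P t / δ) - C * (δ * s + P s / δ)| ≤ C * (2 * A + 2) * δ := by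
      have : C * (δ * t + P t / δ) - C * (δ * s + P s / δ)
          = C * (δ * (t - s) + (P t - P s) / δ) := by ring
      rw [this, abs_mul, abs_of_nonneg hC, mul_assoc]
      refine mul_le_mul_of_nonneg_left ?_ hC
      have h2 : |t - s| ≤ 2 * A := by
        rw [abs_le]; constructor <;> linarith [ht.1, ht.2, hs.1, hs.2]
      have h3 : |P t - P s| ≤ 2 * δ ^ 2 := by
        have := abs_sub (P t) (P s); linarith [hPb t ht, hPb s hs]
      calc |δ * (t - s) + (P t - P s) / δ| ≤ |δ * (t - s)| + |(P t - P s) / δ| := abs_add_le _ _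
        _ = δ * |t - s| + |P t - P s| / δ := by rw [abs_mul, abs_div, abs_of_pos hδ]
        _ ≤ δ * (2 * A) + 2 * δ ^ 2 / δ := by gcongr
        _ = (2 * A + 2) * δ := by field_simp
    have := le_abs_self (e t - e s)
    linarith
  have hmv := Convex.mul_sub_le_image_sub_of_le_deriv (convex_Icc (-A / 2) (A / 2))
    (f := fun s => C * P s + C * δ * s - y s) (C := e t - C * (2 * A + 2) * δ)
  have hsub : Icc (-A / 2) (A / 2) ⊆ Ioo (-A) A := fun s hs => ⟨by linarith [hs.1], by linarith [hs.2]⟩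
  have hd : ∀ s ∈ Ioo (-A) A, HasDerivAt (fun s => C * P s + C * δ * s - y s)
      (C * k s + C * δ * 1 - y' s) s := fun s hs =>
    (((hP s hs).const_mul C).add ((hasDerivAt_id s).const_mul (C * δ))).sub (hy s hs)
  have hmv := hmv (fun s hs => (hd s (hsub hs)).continuousAt.continuousWithinAt)
    (fun s hs => (hd s (hsub (interior_subset hs))).differentiableAt.differentiableWithinAt)
    (fun s hs => by
      have hs := hsub (interior_subset hs)
      rw [(hd s hs).deriv]
      linarith [hosc s hs, hey s hs]) (-A / 2) ⟨le_rfl, by linarith⟩ (A / 2) ⟨by linarith, le_rfl⟩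
      (by linarith)
  have m1 : A / 2 ∈ Ioo (-A) A := ⟨by linarith, by linarith⟩
  have m2 : -A / 2 ∈ Ioo (-A) A := ⟨by linarith, by linarith⟩
  have y1 := abs_le.1 (hyb _ m1)
  have y2 := abs_le.1 (hyb _ m2)
  have p1 := abs_le.1 (hPb _ m1)
  have p2 := abs_le.1 (hPb _ m2)
  have hδ2 : δ ^ 2 ≤ δ := by nlinarith
  have hfin : (e t - C * (2 * A + 2) * δ) * A ≤ C * δ * (4 + A) := by
    have q : C * (P (A / 2) - P (-A / 2)) ≤ C * (2 * δ) :=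
      mul_le_mul_of_nonneg_left (by linarith) hC
    linarith
  have : e t - C * (2 * A + 2) * δ ≤ C * δ * (4 + A) / A := (le_div_iff₀ hA).2 hfin
  calc e t ≤ C * δ * (4 + A) / A + C * (2 * A + 2) * δ := by linarith
    _ = _ := by ring

lemma abs_integral_le_of_pointwise {a b α β γ : ℝ} (hab : a ≤ b) {f u v : ℝ → ℝ}
    (hu : ContinuousOn u (Icc a b)) (hv : ContinuousOn v (Icc a b))
    (h : ∀ r ∈ Icc a b, |f r| ≤ α * (u r ^ 2 * r) + β * (v r ^ 2 * r) + γ * r) :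
    |∫ r in a..b, f r| ≤ α * (∫ r in a..b, u r ^ 2 * r) + β * (∫ r in a..b, v r ^ 2 * r)
      + γ * ∫ r in a..b, r := by
  have iu : IntervalIntegrable (fun r => u r ^ 2 * r) volume a b :=
    ContinuousOn.intervalIntegrable_of_Icc hab (by fun_prop)
  have iv : IntervalIntegrable (fun r => v r ^ 2 * r) volume a b :=
    ContinuousOn.intervalIntegrable_of_Icc hab (by fun_prop)
  have ii : IntervalIntegrable (fun r : ℝ => r) volume a b := continuous_id.intervalIntegrable _ _
  rw [← intervalIntegral.integral_const_mul, ← intervalIntegral.integral_const_mul,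
    ← intervalIntegral.integral_const_mul,
    ← intervalIntegral.integral_add (iu.const_mul α) (iv.const_mul β),
    ← intervalIntegral.integral_add ((iu.const_mul α).add (iv.const_mul β)) (ii.const_mul γ)]
  exact intervalIntegral.norm_integral_le_of_norm_le (f := f) hab
    (Eventually.of_forall fun r hr => h r ⟨hr.1.le, hr.2⟩)
    (((iu.const_mul α).add (iv.const_mul β)).add (ii.const_mul γ))

/-- Localized energy estimate: if `w` and its wave operator are of size `δ` on `(-A,A) × [a,b]` and
the space-time kinetic energy is of size `δ²`, then the localized energy is `O(δ)`. -/
lemma SlabC2.localized_energy_le {A : ℝ} {w wt wr wtt wtr wrr : ℝ → ℝ → ℝ}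
    (h : SlabC2 A w wt wr wtt wtr wrr) (hA : 0 < A) {a b δ K L N : ℝ} (ha : 0 < a) (hab : a < b)
    (hδ : 0 < δ) (hδ1 : δ ≤ 1) (hL : ∀ r ∈ Icc a b, (r - a) * (b - r) ≤ L)
    (hL' : ∀ r ∈ Icc a b, |a + b - 2 * r| ≤ L) (hN : ∫ r in a..b, r ≤ N)
    (hw : ∀ t ∈ Ioo (-A) A, ∀ r ∈ Icc a b, |w t r| ≤ δ)
    (hX : ∀ t ∈ Ioo (-A) A, ∀ r ∈ Icc a b, |r * (wtt t r - wrr t r) - wr t r| ≤ δ * r)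
    (hKt : ∀ t ∈ Ioo (-A) A, ∫ r in a..b, wt t r ^ 2 * r ≤ K)
    (hKr : ∀ t ∈ Ioo (-A) A, ∫ r in a..b, wr t r ^ 2 * r ≤ K)
    {P : ℝ → ℝ} (hP : ∀ t ∈ Ioo (-A) A, HasDerivAt P (∫ r in a..b, wt t r ^ 2 * r) t)
    (hPb : ∀ t ∈ Ioo (-A) A, |P t| ≤ δ ^ 2) {t : ℝ} (ht : t ∈ Ioo (-A) A) :
    ∫ r in a..b, (r - a) * (b - r) * r * (wt t r ^ 2 + wr t r ^ 2) ≤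
      (L * (2 + 2 * N + K)) * ((4 + A) / A + 2 * A + 2) * δ := by
  have hb : 0 < b := ha.trans hab
  have hL0 : 0 ≤ L := (abs_nonneg _).trans (hL' a ⟨le_rfl, hab.le⟩)
  have hN0 : 0 ≤ N := le_trans (intervalIntegral.integral_nonneg hab.le
    fun r hr => ha.le.trans hr.1) hN
  have hK0 : 0 ≤ K := le_trans (intervalIntegral.integral_nonneg hab.le
    fun r hr => mul_nonneg (sq_nonneg _) (ha.le.trans hr.1)) (hKt t ht)
  have hk0 : ∀ t, 0 ≤ ∫ r in a..b, wt t r ^ 2 * r := fun t => intervalIntegral.integral_nonneg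
    hab.le fun r hr => mul_nonneg (sq_nonneg _) (ha.le.trans hr.1)
  have hIcc : Icc a b ⊆ Ioi 0 := fun r hr => ha.trans_le hr.1
  have c := h.c
  have ct := h.ct
  have cr := h.cr
  have ctt := h.ctt
  have ctr := h.ctr
  have crr := h.crr
  have s (t) (ht : t ∈ Ioo (-A) A) : ContinuousOn (fun r => w t r) (Icc a b) :=
    (c.slice ht).mono hIcc
  have st (t) (ht : t ∈ Ioo (-A) A) : ContinuousOn (fun r => wt t r) (Icc a b) :=
    (ct.slice ht).mono hIcc
  have sr (t) (ht : t ∈ Ioo (-A) A) : ContinuousOn (fun r => wr t r) (Icc a b) :=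
    (cr.slice ht).mono hIcc
  have stt (t) (ht : t ∈ Ioo (-A) A) : ContinuousOn (fun r => wtt t r) (Icc a b) :=
    (ctt.slice ht).mono hIcc
  have str (t) (ht : t ∈ Ioo (-A) A) : ContinuousOn (fun r => wtr t r) (Icc a b) :=
    (ctr.slice ht).mono hIcc
  have srr (t) (ht : t ∈ Ioo (-A) A) : ContinuousOn (fun r => wrr t r) (Icc a b) :=
    (crr.slice ht).mono hIcc
  unfold SlabCont at c ct cr ctt ctr crr
  -- integration by parts against the cutoff `(r - a) (b - r)`, which vanishes at `a` and `b`
  have ibp : ∀ u u' v v' : ℝ → ℝ, (∀ r ∈ Icc a b, HasDerivAt u (u' r) r) →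
      (∀ r ∈ Icc a b, HasDerivAt v (v' r) r) → ContinuousOn u' (Icc a b) →
      ContinuousOn v' (Icc a b) →
      ∫ r in a..b, ((a + b - 2 * r) * r * u r * v r + (r - a) * (b - r) * u r * v r
        + (r - a) * (b - r) * r * u' r * v r + (r - a) * (b - r) * r * u r * v' r) = 0 := by
    intro u u' v v' hu hv hu' hv'
    have cu : ContinuousOn u (Icc a b) := fun r hr => (hu r hr).continuousAt.continuousWithinAt
    have cv : ContinuousOn v (Icc a b) := fun r hr => (hv r hr).continuousAt.continuousWithinAt
    have := intervalIntegral.integral_eq_sub_of_hasDerivAt (a := a) (b := b)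
      (f := fun r => (r - a) * (b - r) * r * u r * v r)
      (f' := fun r => (a + b - 2 * r) * r * u r * v r + (r - a) * (b - r) * u r * v r
        + (r - a) * (b - r) * r * u' r * v r + (r - a) * (b - r) * r * u r * v' r) ?_ ?_
    · rw [this]; ring
    · intro r hr
      rw [uIcc_of_le hab.le] at hr
      have := ((((((hasDerivAt_id r).sub_const a).mul ((hasDerivAt_id r).const_sub b)).mul
        (hasDerivAt_id r)).mul (hu r hr)).mul (hv r hr))
      refine this.congr_deriv ?_
      simp only [Pi.mul_apply, id]
      ring
    · exact ContinuousOn.intervalIntegrable_of_Icc hab.le (by fun_prop)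
  refine energy_le_of_averaged_bounds (e := fun t => ∫ r in a..b, (r - a) * (b - r) * r *
      (wt t r ^ 2 + wr t r ^ 2)) (y := fun t => ∫ r in a..b, (r - a) * (b - r) * r * (w t r * wt t r))
    (e' := fun t => ∫ r in a..b, (r - a) * (b - r) * r *
      (2 * wt t r * wtt t r + 2 * wr t r * wtr t r))
    (y' := fun t => ∫ r in a..b, (r - a) * (b - r) * r * (wt t r * wt t r + w t r * wtt t r))
    (k := fun t => ∫ r in a..b, wt t r ^ 2 * r) (P := P)
    hA (by positivity) hδ hδ1 ?_ ?_ hP ?_ ?_ ?_ hPb ht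
  · intro t ht
    refine SlabCont.hasDerivAt_integral_time (A := A)
      (u := fun t r => (r - a) * (b - r) * r * (wt t r ^ 2 + wr t r ^ 2))
      (ut := fun t r => (r - a) * (b - r) * r * (2 * wt t r * wtt t r + 2 * wr t r * wtr t r))
      ?_ ?_ (fun t ht r hr => ?_) ha hb ht
    · unfold SlabCont; fun_prop
    · unfold SlabCont; fun_prop
    have := (((h.dtt t ht r hr).pow 2).add ((h.dtr t ht r hr).pow 2)).const_mul
      ((r - a) * (b - r) * r)
    refine this.congr_deriv ?_
    push_cast; ring
  · intro t ht
    refine SlabCont.hasDerivAt_integral_time (A := A)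
      (u := fun t r => (r - a) * (b - r) * r * (w t r * wt t r))
      (ut := fun t r => (r - a) * (b - r) * r * (wt t r * wt t r + w t r * wtt t r))
      ?_ ?_ (fun t ht r hr => ?_) ha hb ht
    · unfold SlabCont; fun_prop
    · unfold SlabCont; fun_prop
    exact ((h.dt t ht r hr).mul (h.dtt t ht r hr)).const_mul ((r - a) * (b - r) * r)
  · intro t ht
    have s := s t ht
    have st := st t ht
    have sr := sr t ht
    have stt := stt t ht
    have str := str t ht
    have srr := srr t ht
    have e0 := ibp (fun r => wr t r) (fun r => wrr t r) (fun r => wt t r) (fun r => wtr t r)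
      (fun r hr => h.drr t ht r (hIcc hr)) (fun r hr => h.drt t ht r (hIcc hr)) srr str
    have e1 : ∫ r in a..b, (r - a) * (b - r) * r *
        (2 * wt t r * wtt t r + 2 * wr t r * wtr t r) =
        ∫ r in a..b, (2 * ((r - a) * (b - r)) * wt t r * (r * (wtt t r - wrr t r) - wr t r)
          - 2 * (a + b - 2 * r) * r * wr t r * wt t r) := by
      rw [← sub_eq_zero, ← intervalIntegral.integral_sub, ← mul_zero (2 : ℝ), ← e0,
        ← intervalIntegral.integral_const_mul]
      · congr 1; ext r; ring
      · exact ContinuousOn.intervalIntegrable_of_Icc hab.le (by fun_prop)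
      · exact ContinuousOn.intervalIntegrable_of_Icc hab.le (by fun_prop)
    rw [e1]
    refine (abs_integral_le_of_pointwise (α := 2 * L / δ) (β := L * δ) (γ := L * δ) hab.le st sr
      fun r hr => ?_).trans ?_
    · have hr0 : 0 < r := hIcc hr
      have hχ0 : 0 ≤ (r - a) * (b - r) := mul_nonneg (by linarith [hr.1]) (by linarith [hr.2])
      have hχ := hL r hr
      have hχ' := hL' r hr
      have hx := hX t ht r hr
      have y1 : 2 * |wt t r| * δ ≤ wt t r ^ 2 / δ + δ := by
        have h1 : 2 * |wt t r| * δ ≤ wt t r ^ 2 + δ ^ 2 := by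
          nlinarith [sq_nonneg (|wt t r| - δ), sq_abs (wt t r)]
        have h2 : wt t r ^ 2 ≤ wt t r ^ 2 / δ := le_div_self (sq_nonneg _) hδ hδ1
        nlinarith
      have y2 : 2 * |wr t r| * |wt t r| ≤ wt t r ^ 2 / δ + δ * wr t r ^ 2 := by
        rw [← sub_nonneg]
        have : wt t r ^ 2 / δ + δ * wr t r ^ 2 - 2 * |wr t r| * |wt t r|
            = (|wt t r| - δ * |wr t r|) ^ 2 / δ := by
          field_simp; rw [← sq_abs (wt t r), ← sq_abs (wr t r)]; ring
        rw [this]; positivity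
      calc |2 * ((r - a) * (b - r)) * wt t r * (r * (wtt t r - wrr t r) - wr t r)
            - 2 * (a + b - 2 * r) * r * wr t r * wt t r|
          ≤ |2 * ((r - a) * (b - r)) * wt t r * (r * (wtt t r - wrr t r) - wr t r)|
            + |2 * (a + b - 2 * r) * r * wr t r * wt t r| := abs_sub _ _
        _ = 2 * ((r - a) * (b - r)) * |wt t r| * |r * (wtt t r - wrr t r) - wr t r|
            + 2 * |a + b - 2 * r| * r * |wr t r| * |wt t r| := by
          simp only [abs_mul, abs_of_nonneg hχ0, abs_of_pos hr0, abs_two]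
        _ ≤ 2 * L * |wt t r| * (δ * r) + 2 * L * r * |wr t r| * |wt t r| := by gcongr
        _ = L * r * (2 * |wt t r| * δ) + L * r * (2 * |wr t r| * |wt t r|) := by ring
        _ ≤ L * r * (wt t r ^ 2 / δ + δ) + L * r * (wt t r ^ 2 / δ + δ * wr t r ^ 2) := by gcongr
        _ = _ := by ring
    · have := hKr t ht
      have hk := hk0 t
      have hq : 0 ≤ (∫ r in a..b, wt t r ^ 2 * r) / δ := by positivity
      calc _ = L * (2 * ((∫ r in a..b, wt t r ^ 2 * r) / δ) + δ * (∫ r in a..b, wr t r ^ 2 * r)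
            + δ * ∫ r in a..b, r) := by ring
        _ ≤ L * (2 * ((∫ r in a..b, wt t r ^ 2 * r) / δ) + δ * K + δ * N) := by gcongr
        _ ≤ L * ((2 + 2 * N + K) * (δ + (∫ r in a..b, wt t r ^ 2 * r) / δ)) := by
          gcongr
          nlinarith [mul_nonneg hN0 hq, mul_nonneg hK0 hq, mul_nonneg hN0 hδ.le]
        _ = _ := by ring
  · intro t ht
    have s := s t ht
    have st := st t ht
    have sr := sr t ht
    have stt := stt t ht
    have srr := srr t ht
    have e0 := ibp (fun r => w t r) (fun r => wr t r) (fun r => wr t r) (fun r => wrr t r)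
      (fun r hr => h.dr t ht r (hIcc hr)) (fun r hr => h.drr t ht r (hIcc hr)) sr srr
    have e1 : (∫ r in a..b, (r - a) * (b - r) * r * (wt t r ^ 2 + wr t r ^ 2))
        + (∫ r in a..b, (r - a) * (b - r) * r * (wt t r * wt t r + w t r * wtt t r)) =
        ∫ r in a..b, (2 * ((r - a) * (b - r)) * r * wt t r ^ 2
          + (r - a) * (b - r) * w t r * (r * (wtt t r - wrr t r) - wr t r)
          - (a + b - 2 * r) * r * w t r * wr t r) := by
      rw [← intervalIntegral.integral_add, ← sub_eq_zero, ← intervalIntegral.integral_sub, ← e0]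
      · congr 1; ext r; ring
      all_goals exact ContinuousOn.intervalIntegrable_of_Icc hab.le (by fun_prop)
    have e2 := (abs_integral_le_of_pointwise (α := 2 * L) (β := L * δ) (γ := 2 * L * δ) hab.le st sr
      (f := fun r => 2 * ((r - a) * (b - r)) * r * wt t r ^ 2
          + (r - a) * (b - r) * w t r * (r * (wtt t r - wrr t r) - wr t r)
          - (a + b - 2 * r) * r * w t r * wr t r)
      fun r hr => ?_)
    · have := hKr t ht
      have hk := hk0 t
      have e3 := le_abs_self (∫ r in a..b, (2 * ((r - a) * (b - r)) * r * wt t r ^ 2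
          + (r - a) * (b - r) * w t r * (r * (wtt t r - wrr t r) - wr t r)
          - (a + b - 2 * r) * r * w t r * wr t r))
      have e4 : 2 * L * (∫ r in a..b, wt t r ^ 2 * r) + L * δ * (∫ r in a..b, wr t r ^ 2 * r)
          + 2 * L * δ * (∫ r in a..b, r) ≤
          L * (2 + 2 * N + K) * (∫ r in a..b, wt t r ^ 2 * r) + L * (2 + 2 * N + K) * δ := by
        calc _ = L * (2 * (∫ r in a..b, wt t r ^ 2 * r) + δ * (∫ r in a..b, wr t r ^ 2 * r)
            + 2 * (δ * ∫ r in a..b, r)) := by ring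
          _ ≤ L * (2 * (∫ r in a..b, wt t r ^ 2 * r) + δ * K + 2 * (δ * N)) := by gcongr
          _ ≤ L * ((2 + 2 * N + K) * (δ + (∫ r in a..b, wt t r ^ 2 * r))) := by
            gcongr
            nlinarith [mul_nonneg hN0 hk, mul_nonneg hK0 hk, mul_nonneg hN0 hδ.le]
          _ = _ := by ring
      linarith
    · have hr0 : 0 < r := hIcc hr
      have hχ0 : 0 ≤ (r - a) * (b - r) := mul_nonneg (by linarith [hr.1]) (by linarith [hr.2])
      have hχ := hL r hr
      have hχ' := hL' r hr
      have hx := hX t ht r hr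
      have hw := hw t ht r hr
      have y1 : |wr t r| ≤ 1 + wr t r ^ 2 := by nlinarith [sq_nonneg (|wr t r| - 1), sq_abs (wr t r)]
      have hLr : 0 ≤ L * r := by positivity
      calc |2 * ((r - a) * (b - r)) * r * wt t r ^ 2
            + (r - a) * (b - r) * w t r * (r * (wtt t r - wrr t r) - wr t r)
            - (a + b - 2 * r) * r * w t r * wr t r|
          ≤ |2 * ((r - a) * (b - r)) * r * wt t r ^ 2|
            + |(r - a) * (b - r) * w t r * (r * (wtt t r - wrr t r) - wr t r)|
            + |(a + b - 2 * r) * r * w t r * wr t r| :=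
          (abs_sub _ _).trans (by gcongr; exact abs_add_le _ _)
        _ = 2 * ((r - a) * (b - r)) * r * wt t r ^ 2
            + (r - a) * (b - r) * |w t r| * |r * (wtt t r - wrr t r) - wr t r|
            + |a + b - 2 * r| * r * |w t r| * |wr t r| := by
          simp only [abs_mul, abs_of_nonneg hχ0, abs_of_pos hr0, abs_two, abs_pow, sq_abs]
        _ ≤ 2 * L * r * wt t r ^ 2 + L * δ * (δ * r) + L * r * δ * (1 + wr t r ^ 2) := by gcongr
        _ ≤ _ := by nlinarith [mul_nonneg (mul_nonneg hLr hδ.le) (sub_nonneg.2 hδ1)]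
  · intro t ht
    refine (abs_integral_le_of_pointwise (α := L * δ) (β := 0) (γ := L * δ) hab.le (st t ht) (sr t ht)
      fun r hr => ?_).trans ?_
    · have hr0 : 0 < r := hIcc hr
      have hχ0 : 0 ≤ (r - a) * (b - r) := mul_nonneg (by linarith [hr.1]) (by linarith [hr.2])
      have hχ := hL r hr
      have hw := hw t ht r hr
      have y1 : |wt t r| ≤ 1 + wt t r ^ 2 := by nlinarith [sq_nonneg (|wt t r| - 1), sq_abs (wt t r)]
      calc |(r - a) * (b - r) * r * (w t r * wt t r)|
          = (r - a) * (b - r) * r * (|w t r| * |wt t r|) := by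
            simp only [abs_mul, abs_of_nonneg hχ0, abs_of_pos hr0]
        _ ≤ L * r * (δ * (1 + wt t r ^ 2)) := by gcongr
        _ = _ := by ring
    · have := hKt t ht
      calc _ = L * (δ * (∫ r in a..b, wt t r ^ 2 * r) + δ * ∫ r in a..b, r) := by ring
        _ ≤ L * (δ * K + δ * N) := by gcongr
        _ ≤ L * ((2 + 2 * N + K) * δ) := by gcongr; nlinarith [mul_nonneg hN0 hδ.le]
        _ = _ := by ring

lemma setLIntegral_Icc_ofReal {f : ℝ → ℝ} {a b : ℝ} (hab : a ≤ b) (hf : ContinuousOn f (Icc a b))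
    (h0 : ∀ r ∈ Icc a b, 0 ≤ f r) :
    ∫⁻ r in Icc a b, ENNReal.ofReal (f r) = ENNReal.ofReal (∫ r in a..b, f r) := by
  rw [intervalIntegral.integral_of_le hab, ← integral_Icc_eq_integral_Ioc,
    ofReal_integral_eq_lintegral_ofReal (hf.integrableOn_Icc)]
  exact (ae_restrict_iff' measurableSet_Icc).2 (Eventually.of_forall h0)

lemma integral_le_of_lintegral_le {f : ℝ → ℝ} {a b E : ℝ} {s : Set ℝ} (hE : 0 ≤ E) (hab : a ≤ b)
    (hs : Icc a b ⊆ s) (hf : ContinuousOn f (Icc a b)) (h0 : ∀ r ∈ Icc a b, 0 ≤ f r)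
    (h : ∫⁻ r in s, ENNReal.ofReal (f r) ≤ ENNReal.ofReal E) : ∫ r in a..b, f r ≤ E := by
  rw [← ENNReal.ofReal_le_ofReal_iff hE, ← setLIntegral_Icc_ofReal hab hf h0]
  exact (lintegral_mono_set hs).trans h

lemma hasDerivAt_Gfun {g : ℝ → ℝ} (hg : Continuous g) (x : ℝ) :
    HasDerivAt (Gfun g) |g x| x :=
  intervalIntegral.integral_hasDerivAt_right (hg.abs.intervalIntegrable _ _)
    (hg.abs.stronglyMeasurableAtFilter _ _) hg.abs.continuousAt

lemma abs_integral_sub_le {v v' p : ℝ → ℝ} {a b : ℝ} (hab : a ≤ b)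
    (hv : ∀ r ∈ Icc a b, HasDerivAt v (v' r) r) (hv' : ContinuousOn v' (Icc a b))
    (hp : ContinuousOn p (Icc a b)) (hle : ∀ r ∈ Icc a b, |v' r| ≤ p r) :
    |v b - v a| ≤ ∫ r in a..b, p r := by
  rw [← intervalIntegral.integral_eq_sub_of_hasDerivAt (f' := v')
    (fun r hr => hv r (by rwa [uIcc_of_le hab] at hr)) (hv'.intervalIntegrable_of_Icc hab)]
  exact intervalIntegral.norm_integral_le_of_norm_le (f := v') hab
    (Eventually.of_forall fun r hr => hle r ⟨hr.1.le, hr.2⟩) (hp.intervalIntegrable_of_Icc hab)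

lemma abs_mul_le_energy_density (x y r : ℝ) (hr : 0 < r) :
    |x| * |y| ≤ (y ^ 2 + x ^ 2 / r ^ 2) * r := by
  have h : (y ^ 2 + x ^ 2 / r ^ 2) * r = (|y| * r - |x|) ^ 2 / r + 2 * (|x| * |y|) := by
    field_simp
    rw [← sq_abs x, ← sq_abs y]
    ring
  rw [h]
  have : 0 ≤ (|y| * r - |x|) ^ 2 / r := by positivity
  nlinarith [mul_nonneg (abs_nonneg x) (abs_nonneg y)]

/-- The energy controls the oscillation of `G ∘ v`. -/
lemma abs_Gfun_sub_le {g v v' : ℝ → ℝ} (hg : Continuous g) {a b : ℝ} (ha : 0 < a) (hab : a ≤ b)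
    (hv : ∀ r ∈ Icc a b, HasDerivAt v (v' r) r) (hv' : ContinuousOn v' (Icc a b)) :
    |Gfun g (v b) - Gfun g (v a)| ≤ ∫ r in a..b, (v' r ^ 2 + g (v r) ^ 2 / r ^ 2) * r := by
  have hc : ContinuousOn v (Icc a b) := fun r hr => (hv r hr).continuousAt.continuousWithinAt
  have hpos : ∀ r ∈ Icc a b, r ≠ 0 := fun r hr => (ha.trans_le hr.1).ne'
  refine abs_integral_sub_le (v := fun r => Gfun g (v r)) (v' := fun r => |g (v r)| * v' r) hab
    (fun r hr => (hasDerivAt_Gfun hg (v r)).comp r (hv r hr)) ?_ ?_ (fun r hr => ?_)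
  · exact ((hg.comp_continuousOn hc).abs).mul hv'
  · have := hg.comp_continuousOn hc
    refine ((hv'.pow 2).add ((this.pow 2).div (by fun_prop) fun r hr => ?_)).mul continuousOn_id
    exact pow_ne_zero 2 (hpos r hr)
  · rw [abs_mul, abs_abs]
    exact abs_mul_le_energy_density _ _ _ (ha.trans_le hr.1)

/-- Hölder-type continuity from a bound on the radial part of the energy. -/
lemma abs_sub_le_of_radial_energy {v v' : ℝ → ℝ} {a b E lam : ℝ} (ha : 0 < a) (hab : a ≤ b)
    (hlam : 0 < lam)
    (hv : ∀ r ∈ Icc a b, HasDerivAt v (v' r) r) (hv' : ContinuousOn v' (Icc a b))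
    (hE : ∫ r in a..b, v' r ^ 2 * r ≤ E) :
    |v b - v a| ≤ lam * E + (b - a) / (lam * a) := by
  have h := abs_integral_sub_le (p := fun r => lam * (v' r ^ 2 * r) + 1 / (lam * a)) hab hv hv'
    (by fun_prop) (fun r hr => ?_)
  · rw [intervalIntegral.integral_add, intervalIntegral.integral_const_mul,
      intervalIntegral.integral_const, smul_eq_mul, mul_one_div] at h
    · exact h.trans (by gcongr)
    · exact ContinuousOn.intervalIntegrable_of_Icc hab (by fun_prop)
    · exact intervalIntegrable_const
  · have h1 : |v' r| ≤ lam * a * v' r ^ 2 + 1 / (lam * a) := by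
      have hla : 0 < lam * a := by positivity
      have : lam * a * v' r ^ 2 + 1 / (lam * a) =
          (lam * a * |v' r| - 1) ^ 2 / (lam * a) + 2 * |v' r| := by
        field_simp; rw [← sq_abs (v' r)]; ring
      rw [this]
      have : 0 ≤ (lam * a * |v' r| - 1) ^ 2 / (lam * a) := by positivity
      linarith [abs_nonneg (v' r)]
    have h2 : lam * a * v' r ^ 2 ≤ lam * (v' r ^ 2 * r) := by
      have := mul_le_mul_of_nonneg_left hr.1 (by positivity : 0 ≤ lam * v' r ^ 2)
      linarith
    linarith

/-- Oscillation in time at a fixed radius, in terms of the space-time kinetic energy. -/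
lemma SlabC2.abs_sub_time_le {A : ℝ} {w wt wr wtt wtr wrr : ℝ → ℝ → ℝ}
    (hw : SlabC2 A w wt wr wtt wtr wrr) {a b h lam δ E : ℝ} (ha : 0 < a)
    (hh : 0 < h) (hh1 : h ≤ 1) (hlam : 0 < lam) (hδ : 0 < δ)
    (hE : ∀ t ∈ Ioo (-A) A, ∫ r in a..(b + 1), wr t r ^ 2 * r ≤ E)
    {P : ℝ → ℝ} (hP : ∀ t ∈ Ioo (-A) A, HasDerivAt P (∫ r in a..(b + 1), wt t r ^ 2 * r) t)
    (hPb : ∀ t ∈ Ioo (-A) A, |P t| ≤ δ ^ 2) {r : ℝ} (hr : r ∈ Icc a b) {s t : ℝ}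
    (hs : s ∈ Ioo (-A) A) (ht : t ∈ Ioo (-A) A) :
    |w t r - w s r| ≤ 2 * (lam * E + h / (lam * a)) + (2 * A + 2 / (a * h)) * δ := by
  have hr0 : 0 < r := ha.trans_le hr.1
  have hsub : Icc r (r + h) ⊆ Icc a (b + 1) := Icc_subset_Icc hr.1 (by linarith [hr.2])
  have hsub0 : Icc a (b + 1) ⊆ Ioi 0 := fun x hx => ha.trans_le hx.1
  have hrh : r ≤ r + h := by linarith
  have hmono : ∀ v : ℝ → ℝ, ContinuousOn v (Icc a (b + 1)) → ∀ c d, a ≤ c → c ≤ d → d ≤ b + 1 →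
      ∫ x in c..d, v x ^ 2 * x ≤ ∫ x in a..(b + 1), v x ^ 2 * x := by
    intro v hv c d hc hcd hd
    have hab : a ≤ b + 1 := by linarith
    refine intervalIntegral.integral_mono_interval hc hcd hd ?_ ?_
    · refine (ae_restrict_iff' measurableSet_Ioc).2 (Eventually.of_forall fun x hx => ?_)
      exact mul_nonneg (sq_nonneg _) (ha.le.trans hx.1.le)
    · exact ContinuousOn.intervalIntegrable_of_Icc hab (by fun_prop)
  have hspace : ∀ t ∈ Ioo (-A) A, ∀ ρ ∈ Icc r (r + h),
      |w t ρ - w t r| ≤ lam * E + h / (lam * a) := by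
    intro t ht ρ hρ
    have hρ' := hsub hρ
    have hsub2 : Icc r ρ ⊆ Icc a (b + 1) := Icc_subset_Icc hr.1 hρ'.2
    refine (abs_sub_le_of_radial_energy (v := fun x => w t x) (v' := fun x => wr t x) hr0 hρ.1 hlam
      (fun x hx => hw.dr t ht x (hsub0 (hsub2 hx)))
      ((hw.cr.slice ht).mono (hsub2.trans hsub0))
      ((hmono _ ((hw.cr.slice ht).mono hsub0) r ρ hr.1 hρ.1 hρ'.2).trans (hE t ht))).trans ?_
    gcongr
    · linarith [hρ.2]
    · exact hr.1
  have hI := abs_sub_le_abs_sub_of_deriv_le (A := A) (u := fun t => ∫ ρ in r..(r + h), w t ρ)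
    (u' := fun t => ∫ ρ in r..(r + h), wt t ρ)
    (p := fun t => h * δ * t + P t / (a * δ))
    (fun t ht => hw.c.hasDerivAt_integral_time hw.ct hw.dt hr0 (by linarith) ht)
    (fun t ht => ((hasDerivAt_id t).const_mul (h * δ)).add ((hP t ht).div_const (a * δ)))
    (fun t ht => ?_) hs ht
  · have hPd : |h * δ * t + P t / (a * δ) - (h * δ * s + P s / (a * δ))|
        ≤ h * δ * (2 * A) + 2 * δ ^ 2 / (a * δ) := by
      have h2 : |t - s| ≤ 2 * A := by
        rw [abs_le]; constructor <;> linarith [ht.1, ht.2, hs.1, hs.2]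
      have h3 : |P t - P s| ≤ 2 * δ ^ 2 := by
        have := abs_sub (P t) (P s); linarith [hPb t ht, hPb s hs]
      have haδ : 0 < a * δ := by positivity
      have hhδ : 0 < h * δ := by positivity
      calc _ = |h * δ * (t - s) + (P t - P s) / (a * δ)| := by congr 1; ring
        _ ≤ |h * δ * (t - s)| + |(P t - P s) / (a * δ)| := abs_add_le _ _
        _ = h * δ * |t - s| + |P t - P s| / (a * δ) := by
          rw [abs_mul (h * δ), abs_div, abs_of_pos haδ, abs_of_pos hhδ]
        _ ≤ _ := by gcongr
    have hI := hI.trans hPd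
    have havg : ∀ t ∈ Ioo (-A) A, |(∫ ρ in r..(r + h), w t ρ) - h * w t r|
        ≤ (lam * E + h / (lam * a)) * h := by
      intro t ht
      have hc : ContinuousOn (fun ρ => w t ρ) (Icc r (r + h)) :=
        (hw.c.slice ht).mono (hsub.trans hsub0)
      have e : (∫ ρ in r..(r + h), w t ρ) - h * w t r = ∫ ρ in r..(r + h), (w t ρ - w t r) := by
        rw [intervalIntegral.integral_sub (hc.intervalIntegrable_of_Icc hrh)
          intervalIntegrable_const, intervalIntegral.integral_const]
        simp
      rw [e]
      have := intervalIntegral.norm_integral_le_of_norm_le_const (a := r) (b := r + h)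
        (f := fun ρ => w t ρ - w t r) (C := lam * E + h / (lam * a)) (fun ρ hρ => by
          rw [uIoc_of_le hrh] at hρ
          exact hspace t ht ρ ⟨hρ.1.le, hρ.2⟩)
      simpa [abs_of_pos hh] using this
    have key : h * |w t r - w s r| ≤ h * (2 * (lam * E + h / (lam * a)) + (2 * A + 2 / (a * h)) * δ)
        := by
      have e1 : h * |w t r - w s r| = |h * w t r - h * w s r| := by
        rw [← mul_sub, abs_mul, abs_of_pos hh]
      rw [e1]
      have b1 := abs_le.1 (havg t ht)
      have b2 := abs_le.1 (havg s hs)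
      have b3 := abs_le.1 hI
      have e2 : h * (2 * (lam * E + h / (lam * a)) + (2 * A + 2 / (a * h)) * δ) =
          2 * ((lam * E + h / (lam * a)) * h) + (h * δ * (2 * A) + 2 * δ ^ 2 / (a * δ)) := by
        field_simp
      rw [e2, abs_le]
      constructor <;> linarith [b1.1, b1.2, b2.1, b2.2, b3.1, b3.2]
    exact le_of_mul_le_mul_left key hh
  · have hct : ContinuousOn (fun ρ => wt t ρ) (Icc a (b + 1)) := (hw.ct.slice ht).mono hsub0
    have hct' := hct.mono hsub
    have h1 : |∫ ρ in r..(r + h), wt t ρ| ≤ ∫ ρ in r..(r + h), (δ + (wt t ρ ^ 2 * ρ) / (a * δ)) := by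
      refine intervalIntegral.norm_integral_le_of_norm_le (f := fun ρ => wt t ρ) hrh
        (Eventually.of_forall fun ρ hρ => ?_)
        (ContinuousOn.intervalIntegrable_of_Icc hrh (by fun_prop))
      have haρ : a ≤ ρ := hr.1.trans hρ.1.le
      have h2 : wt t ρ ^ 2 / δ ≤ wt t ρ ^ 2 * ρ / (a * δ) := by
        rw [div_le_div_iff₀ hδ (by positivity)]
        have := mul_le_mul_of_nonneg_left haρ (by positivity : 0 ≤ wt t ρ ^ 2 * δ)
        linarith
      have h3 : |wt t ρ| ≤ δ + wt t ρ ^ 2 / δ := by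
        have : δ + wt t ρ ^ 2 / δ = (|wt t ρ| - δ) ^ 2 / δ + 2 * |wt t ρ| := by
          field_simp; rw [← sq_abs (wt t ρ)]; ring
        rw [this]
        have : 0 ≤ (|wt t ρ| - δ) ^ 2 / δ := by positivity
        linarith [abs_nonneg (wt t ρ)]
      rw [Real.norm_eq_abs]
      linarith
    refine h1.trans ?_
    rw [intervalIntegral.integral_add, intervalIntegral.integral_const,
      intervalIntegral.integral_div]
    · have := hmono _ hct r (r + h) hr.1 hrh (by linarith [hr.2])
      simp only [add_sub_cancel_left, smul_eq_mul, mul_one]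
      gcongr
    · exact intervalIntegrable_const
    · exact ContinuousOn.intervalIntegrable_of_Icc hrh (by fun_prop)

lemma continuousOn_energy_density {g v v' z : ℝ → ℝ} (hg : Continuous g) {s : Set ℝ}
    (hs : ∀ r ∈ s, 0 < r) (hv : ContinuousOn v s) (hv' : ContinuousOn v' s)
    (hz : ContinuousOn z s) :
    ContinuousOn (fun r => (z r ^ 2 + v' r ^ 2 + g (v r) ^ 2 / r ^ 2) * r) s := by
  have hgv := hg.comp_continuousOn hv
  refine (((hz.pow 2).add (hv'.pow 2)).add
    ((hgv.pow 2).div (by fun_prop) fun r hr => ?_)).mul continuousOn_id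
  exact pow_ne_zero 2 (hs r hr).ne'

section Bounds

variable {A E : ℝ} {g : ℝ → ℝ} {ψ m : ℝ → ℝ → ℝ}

/-- The energy bound, expressed with interval integrals on compact annuli. -/
lemma SlabC2.integral_energy_le (hψ : SlabC2 A ψ (pdt ψ) (pdr ψ) (pdtt ψ) m (pdrr ψ))
    (hg : Continuous g) (hE : 0 ≤ E)
    (hen : ∀ t ∈ Icc (-A) A, energyOn g (ψ t) (pdt ψ t) (Ioi 0) ≤ ENNReal.ofReal E)
    {a b : ℝ} (ha : 0 < a) (hab : a ≤ b) {t : ℝ} (ht : t ∈ Ioo (-A) A) :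
    ∫ r in a..b, (pdt ψ t r ^ 2 + pdr ψ t r ^ 2 + g (ψ t r) ^ 2 / r ^ 2) * r ≤ E := by
  have hsub : Icc a b ⊆ Ioi 0 := fun x hx => ha.trans_le hx.1
  refine integral_le_of_lintegral_le hE hab hsub ?_ (fun r hr => ?_) (hen t (Ioo_subset_Icc_self ht))
  · exact continuousOn_energy_density hg (fun r hr => hsub hr) ((hψ.c.slice ht).mono hsub)
      ((hψ.cr.slice ht).mono hsub) ((hψ.ct.slice ht).mono hsub)
  · have : 0 < r := hsub hr
    positivity

lemma SlabC2.integral_le_of_density_le (hψ : SlabC2 A ψ (pdt ψ) (pdr ψ) (pdtt ψ) m (pdrr ψ))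
    (hg : Continuous g) (hE : 0 ≤ E)
    (hen : ∀ t ∈ Icc (-A) A, energyOn g (ψ t) (pdt ψ t) (Ioi 0) ≤ ENNReal.ofReal E)
    {a b : ℝ} (ha : 0 < a) (hab : a ≤ b) {t : ℝ} (ht : t ∈ Ioo (-A) A) {f : ℝ → ℝ}
    (hf : ContinuousOn f (Icc a b)) (hle : ∀ r ∈ Icc a b,
      f r ≤ (pdt ψ t r ^ 2 + pdr ψ t r ^ 2 + g (ψ t r) ^ 2 / r ^ 2) * r) :
    ∫ r in a..b, f r ≤ E := by
  have hsub : Icc a b ⊆ Ioi 0 := fun x hx => ha.trans_le hx.1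
  refine le_trans (intervalIntegral.integral_mono_on hab (hf.intervalIntegrable_of_Icc hab) ?_ hle)
    (hψ.integral_energy_le hg hE hen ha hab ht)
  exact (continuousOn_energy_density hg (fun r hr => hsub hr) ((hψ.c.slice ht).mono hsub)
      ((hψ.cr.slice ht).mono hsub) ((hψ.ct.slice ht).mono hsub)).intervalIntegrable_of_Icc hab

lemma SlabC2.integral_pdt_le (hψ : SlabC2 A ψ (pdt ψ) (pdr ψ) (pdtt ψ) m (pdrr ψ))
    (hg : Continuous g) (hE : 0 ≤ E)
    (hen : ∀ t ∈ Icc (-A) A, energyOn g (ψ t) (pdt ψ t) (Ioi 0) ≤ ENNReal.ofReal E)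
    {a b : ℝ} (ha : 0 < a) (hab : a ≤ b) {t : ℝ} (ht : t ∈ Ioo (-A) A) :
    ∫ r in a..b, pdt ψ t r ^ 2 * r ≤ E := by
  have hsub : Icc a b ⊆ Ioi 0 := fun x hx => ha.trans_le hx.1
  have h1 := (hψ.ct.slice ht).mono hsub
  refine hψ.integral_le_of_density_le hg hE hen ha hab ht (by fun_prop) (fun r hr => ?_)
  have hr0 : 0 < r := hsub hr
  have : 0 ≤ (pdr ψ t r ^ 2 + g (ψ t r) ^ 2 / r ^ 2) * r := by positivity
  linarith

lemma SlabC2.integral_pdr_le (hψ : SlabC2 A ψ (pdt ψ) (pdr ψ) (pdtt ψ) m (pdrr ψ))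
    (hg : Continuous g) (hE : 0 ≤ E)
    (hen : ∀ t ∈ Icc (-A) A, energyOn g (ψ t) (pdt ψ t) (Ioi 0) ≤ ENNReal.ofReal E)
    {a b : ℝ} (ha : 0 < a) (hab : a ≤ b) {t : ℝ} (ht : t ∈ Ioo (-A) A) :
    ∫ r in a..b, pdr ψ t r ^ 2 * r ≤ E := by
  have hsub : Icc a b ⊆ Ioi 0 := fun x hx => ha.trans_le hx.1
  have h1 := (hψ.cr.slice ht).mono hsub
  refine hψ.integral_le_of_density_le hg hE hen ha hab ht (by fun_prop) (fun r hr => ?_)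
  have hr0 : 0 < r := hsub hr
  have : 0 ≤ (pdt ψ t r ^ 2 + g (ψ t r) ^ 2 / r ^ 2) * r := by positivity
  linarith

lemma SlabC2.integral_static_energy_le (hψ : SlabC2 A ψ (pdt ψ) (pdr ψ) (pdtt ψ) m (pdrr ψ))
    (hg : Continuous g) (hE : 0 ≤ E)
    (hen : ∀ t ∈ Icc (-A) A, energyOn g (ψ t) (pdt ψ t) (Ioi 0) ≤ ENNReal.ofReal E)
    {a b : ℝ} (ha : 0 < a) (hab : a ≤ b) {t : ℝ} (ht : t ∈ Ioo (-A) A) :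
    ∫ r in a..b, (pdr ψ t r ^ 2 + g (ψ t r) ^ 2 / r ^ 2) * r ≤ E := by
  have hsub : Icc a b ⊆ Ioi 0 := fun x hx => ha.trans_le hx.1
  have := continuousOn_energy_density hg (fun r hr => hsub hr) ((hψ.c.slice ht).mono hsub)
      ((hψ.cr.slice ht).mono hsub) (continuousOn_const (c := (0 : ℝ)))
  refine hψ.integral_le_of_density_le hg hE hen ha hab ht (this.congr fun r hr => ?_)
    (fun r hr => ?_)
  · simp
  · have hr0 : 0 < r := hsub hr
    have : 0 ≤ pdt ψ t r ^ 2 * r := by positivity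
    linarith

lemma SlabC2.abs_Gfun_sub_limit_le (hψ : SlabC2 A ψ (pdt ψ) (pdr ψ) (pdtt ψ) m (pdrr ψ))
    (hg : Continuous g) (hE : 0 ≤ E)
    (hen : ∀ t ∈ Icc (-A) A, energyOn g (ψ t) (pdt ψ t) (Ioi 0) ≤ ENNReal.ofReal E)
    {ℓ t : ℝ} (ht : t ∈ Ioo (-A) A) (hℓ : Tendsto (ψ t) (𝓝[>] (0:ℝ)) (𝓝 ℓ)) {r : ℝ} (hr : 0 < r) :
    |Gfun g (ψ t r) - Gfun g ℓ| ≤ E := by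
  have hG : Continuous (Gfun g) :=
    continuous_iff_continuousAt.2 fun x => (hasDerivAt_Gfun hg x).continuousAt
  have hlim : Tendsto (fun ρ => |Gfun g (ψ t r) - Gfun g (ψ t ρ)|) (𝓝[>] 0)
      (𝓝 |Gfun g (ψ t r) - Gfun g ℓ|) :=
    (tendsto_const_nhds.sub ((hG.tendsto ℓ).comp hℓ)).abs
  refine le_of_tendsto hlim ?_
  filter_upwards [Ioo_mem_nhdsGT hr] with ρ hρ
  have hsub : Icc ρ r ⊆ Ioi 0 := fun x hx => hρ.1.trans_le hx.1
  exact (abs_Gfun_sub_le hg hρ.1 hρ.2.le (fun x hx => hψ.dr t ht x (hsub hx))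
    ((hψ.cr.slice ht).mono hsub)).trans
    (hψ.integral_static_energy_le hg hE hen hρ.1 hρ.2.le ht)

/-- A primitive of the local kinetic energy which is small when the space-time kinetic energy is. -/
lemma SlabC2.exists_kinetic_primitive (hψ : SlabC2 A ψ (pdt ψ) (pdr ψ) (pdtt ψ) m (pdrr ψ))
    (hA : 0 < A) {a b ρ κ : ℝ} (ha : 0 < a) (hab : a ≤ b) (hb : b < ρ) (hκ : 0 ≤ κ)
    (hkin : ∫⁻ t in Icc (-A) A, ∫⁻ r in Ioo 0 ρ, ENNReal.ofReal ((pdt ψ t r) ^ 2 * r)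
      ≤ ENNReal.ofReal κ) :
    ∃ P : ℝ → ℝ, (∀ t ∈ Ioo (-A) A, HasDerivAt P (∫ r in a..b, pdt ψ t r ^ 2 * r) t) ∧
      ∀ t ∈ Ioo (-A) A, |P t| ≤ κ := by
  have hsub : Icc a b ⊆ Ioi 0 := fun x hx => ha.trans_le hx.1
  set k : ℝ → ℝ := fun t => ∫ r in a..b, pdt ψ t r ^ 2 * r with hk
  have hkc : ContinuousOn k (Ioo (-A) A) := by
    intro t ht
    have c := hψ.ct
    have ctt := hψ.ctt
    unfold SlabCont at c ctt
    refine (SlabCont.hasDerivAt_integral_time (A := A) (u := fun t r => pdt ψ t r ^ 2 * r)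
      (ut := fun t r => 2 * pdt ψ t r * pdtt ψ t r * r) (by unfold SlabCont; fun_prop)
      (by unfold SlabCont; fun_prop) (fun t ht r hr => ?_) ha (ha.trans_le hab)
      ht).continuousAt.continuousWithinAt
    refine (((hψ.dtt t ht r hr).pow 2).mul_const r).congr_deriv ?_
    push_cast; ring
  have hk0 : ∀ t, 0 ≤ k t := fun t => intervalIntegral.integral_nonneg hab fun r hr =>
    mul_nonneg (sq_nonneg _) (ha.le.trans hr.1)
  have h0 : (0 : ℝ) ∈ Ioo (-A) A := ⟨by linarith, hA⟩
  have hu : ∀ t ∈ Ioo (-A) A, uIcc 0 t ⊆ Ioo (-A) A := fun t ht =>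
    ordConnected_Ioo.uIcc_subset h0 ht
  refine ⟨fun t => ∫ s in (0:ℝ)..t, k s, fun t ht => ?_, fun t ht => ?_⟩
  · exact intervalIntegral.integral_hasDerivAt_right ((hkc.mono (hu t ht)).intervalIntegrable)
      (hkc.stronglyMeasurableAtFilter isOpen_Ioo t ht) (hkc.continuousAt (isOpen_Ioo.mem_nhds ht))
  · rw [← ENNReal.ofReal_le_ofReal_iff hκ, intervalIntegral.abs_intervalIntegral_eq,
      abs_of_nonneg (integral_nonneg hk0), ofReal_integral_eq_lintegral_ofReal
        ((hkc.mono (hu t ht)).integrableOn_uIcc.mono_set uIoc_subset_uIcc)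
        (Eventually.of_forall hk0)]
    have hsub2 : uIoc 0 t ⊆ Ioo (-A) A := uIoc_subset_uIcc.trans (hu t ht)
    refine le_trans ?_ hkin
    refine le_trans (setLIntegral_mono' measurableSet_uIoc fun s hs => ?_)
      (lintegral_mono_set (hsub2.trans Ioo_subset_Icc_self))
    have c := (hψ.ct.slice (hsub2 hs)).mono hsub
    rw [hk, ← setLIntegral_Icc_ofReal hab (by fun_prop) fun r hr =>
      mul_nonneg (sq_nonneg _) (ha.le.trans hr.1)]
    exact lintegral_mono_set fun r hr => ⟨ha.trans_le hr.1, hr.2.trans_lt hb⟩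

end Bounds

/-- A bound on `G(x)` gives a bound on `x`. -/
lemma exists_bound_of_Gfun_bound {g : ℝ → ℝ} (hA1 : A1 g) (C : ℝ) :
    ∃ M : ℝ, 0 ≤ M ∧ ∀ x, |Gfun g x| ≤ C → |x| ≤ M := by
  obtain ⟨x₁, h₁⟩ := (eventually_atTop.1 (hA1.1.eventually_gt_atTop C))
  obtain ⟨x₂, h₂⟩ := (eventually_atBot.1 (hA1.2.eventually_lt_atBot (-C)))
  refine ⟨max |x₁| |x₂|, le_max_of_le_left (abs_nonneg _), fun x hx => abs_le.2 ⟨?_, ?_⟩⟩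
  · by_contra! hlt
    have : x ≤ x₂ := by
      have := neg_abs_le x₂
      have := le_max_right |x₁| |x₂|
      linarith
    have := h₂ x this
    linarith [(abs_le.1 hx).1]
  · by_contra! hlt
    have : x₁ ≤ x := by
      have := le_abs_self x₁
      have := le_max_left |x₁| |x₂|
      linarith
    have := h₁ x this
    linarith [(abs_le.1 hx).2]

/-- Arzelà–Ascoli on `(0,∞)`, in the form of locally uniform convergence of a subsequence. -/
lemma exists_subseq_tendsto_locally_uniformly {q : ℕ → ℝ → ℝ} {M : ℝ}
    (hM : ∀ n, ∀ r, 0 < r → |q n r| ≤ M)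
    (heq : ∀ a b, 0 < a → ∀ ε > 0, ∃ η > 0, ∀ n, ∀ r ∈ Icc a b, ∀ s ∈ Icc a b, |r - s| < η →
      |q n r - q n s| ≤ ε) :
    ∃ σ : ℕ → ℕ, StrictMono σ ∧ ∃ Q : ℝ → ℝ, ∀ a b, 0 < a → ∀ ε > 0, ∀ᶠ n in atTop,
      ∀ r ∈ Icc a b, |q (σ n) r - Q r| ≤ ε := by
  have hM0 : 0 ≤ M := (abs_nonneg _).trans (hM 0 1 one_pos)
  have hcomp : IsCompact (univ.pi fun _ : ℚ => Icc (-M) M) :=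
    isCompact_univ_pi fun _ => isCompact_Icc
  obtain ⟨L, -, σ, hσ, hL⟩ := hcomp.tendsto_subseq
    (x := fun n (x : ℚ) => if 0 < (x : ℝ) then q n x else 0) (fun n x _ => by
      by_cases hx : 0 < (x : ℝ)
      · simp only [if_pos hx]; exact abs_le.1 (hM n x hx)
      · simp only [if_neg hx]; exact ⟨by linarith, hM0⟩)
  rw [tendsto_pi_nhds] at hL
  have hrat : ∀ x : ℚ, 0 < (x : ℝ) → CauchySeq fun n => q (σ n) x := fun x hx => by
    have := (hL x).cauchySeq
    simp only [Function.comp_def, if_pos hx] at this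
    exact this
  have hcau : ∀ r : ℝ, 0 < r → CauchySeq fun n => q (σ n) r := by
    intro r hr
    rw [Metric.cauchySeq_iff]
    intro ε hε
    obtain ⟨η, hη, h⟩ := heq (r / 2) (2 * r) (by linarith) (ε / 4) (by linarith)
    obtain ⟨x, hx1, hx2⟩ := exists_rat_btwn (show max (r / 2) (r - η) < r from
      max_lt (by linarith) (by linarith))
    have hx3 := (max_lt_iff.1 hx1)
    have hxI : (x : ℝ) ∈ Icc (r / 2) (2 * r) := ⟨hx3.1.le, by linarith⟩
    have hrI : r ∈ Icc (r / 2) (2 * r) := ⟨by linarith, by linarith⟩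
    obtain ⟨N, hN⟩ := Metric.cauchySeq_iff.1 (hrat x (by linarith [hx3.1])) (ε / 4) (by linarith)
    refine ⟨N, fun m hm n hn => ?_⟩
    have hd : |r - x| < η := by rw [abs_lt]; constructor <;> linarith [hx3.2]
    have b1 := abs_le.1 (h (σ m) r hrI x hxI hd)
    have b2 := abs_le.1 (h (σ n) r hrI x hxI hd)
    have b3 := hN m hm n hn
    rw [Real.dist_eq] at b3 ⊢
    have b3 := abs_lt.1 b3
    rw [abs_lt]
    constructor <;> linarith [b1.1, b1.2, b2.1, b2.2, b3.1, b3.2]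
  have hlim : ∀ r : ℝ, ∃ y, 0 < r → Tendsto (fun n => q (σ n) r) atTop (𝓝 y) := by
    intro r
    by_cases hr : 0 < r
    · obtain ⟨y, hy⟩ := cauchySeq_tendsto_of_complete (hcau r hr)
      exact ⟨y, fun _ => hy⟩
    · exact ⟨0, fun h => absurd h hr⟩
  choose Q hQ using hlim
  refine ⟨σ, hσ, Q, fun a b ha ε hε => ?_⟩
  obtain ⟨η, hη, h⟩ := heq a b ha (ε / 3) (by linarith)
  obtain ⟨T, hTs, hT⟩ := isCompact_Icc.elim_nhds_subcover (s := Icc a b)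
    (fun x => Metric.ball x η) (fun x _ => Metric.ball_mem_nhds x hη)
  have hpos : ∀ r ∈ Icc a b, 0 < r := fun r hr => ha.trans_le hr.1
  have hQmod : ∀ r ∈ Icc a b, ∀ s ∈ Icc a b, |r - s| < η → |Q r - Q s| ≤ ε / 3 :=
    fun r hr s hs hrs => le_of_tendsto
      (((hQ r (hpos r hr)).sub (hQ s (hpos s hs))).abs)
      (Eventually.of_forall fun n => h (σ n) r hr s hs hrs)
  have hev : ∀ᶠ n in atTop, ∀ x ∈ T, |q (σ n) x - Q x| < ε / 3 := by
    rw [Finset.eventually_all]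
    intro x hx
    have := (Metric.tendsto_nhds.1 (hQ x (hpos x (hTs x hx)))) (ε / 3) (by linarith)
    simpa only [Real.dist_eq] using this
  filter_upwards [hev] with n hn r hr
  obtain ⟨x, hxT, hx⟩ := mem_iUnion₂.1 (hT hr)
  rw [Metric.mem_ball, Real.dist_eq] at hx
  have b1 := abs_le.1 (h (σ n) r hr x (hTs x hxT) hx)
  have b2 := abs_le.1 (hQmod r hr x (hTs x hxT) hx)
  have b3 := abs_lt.1 (hn x hxT)
  rw [abs_le]
  constructor <;> linarith [b1.1, b1.2, b2.1, b2.2, b3.1, b3.2]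

lemma exists_antideriv_Ioi {h : ℝ → ℝ} (hh : ContinuousOn h (Ioi 0)) :
    ∃ H : ℝ → ℝ, ∀ r, 0 < r → HasDerivAt H (h r) r :=
  ⟨fun r => ∫ s in (1:ℝ)..r, h s, fun r hr => intervalIntegral.integral_hasDerivAt_right
    ((hh.mono (uIcc_subset_Ioi_zero one_pos hr)).intervalIntegrable)
    (hh.stronglyMeasurableAtFilter isOpen_Ioi r hr) (hh.continuousAt (isOpen_Ioi.mem_nhds hr))⟩

/-- Stability of the radial equation `(r U')' = h` under limits. -/
lemma radial_ode_of_tendsto {U V h : ℕ → ℝ → ℝ} {u f : ℝ → ℝ}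
    (hU : ∀ n, ∀ r, 0 < r → HasDerivAt (U n) (V n r) r)
    (hV : ∀ n, ∀ r, 0 < r → HasDerivAt (fun r => r * V n r) (h n r) r)
    (hu : ∀ r, 0 < r → Tendsto (fun n => U n r) atTop (𝓝 (u r)))
    (hf : ContinuousOn f (Ioi 0))
    (hh : ∀ a b, 0 < a → ∀ ε > 0, ∀ᶠ n in atTop, ∀ r ∈ Icc a b, |h n r - f r| ≤ ε) :
    ∃ v : ℝ → ℝ, ∀ r, 0 < r → HasDerivAt u (v r) r ∧ HasDerivAt (fun r => r * v r) (f r) r := by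
  obtain ⟨H, hH⟩ := exists_antideriv_Ioi hf
  obtain ⟨K, hK⟩ := exists_antideriv_Ioi (h := fun r => H r / r)
    (ContinuousOn.div (fun r hr => (hH r hr).continuousAt.continuousWithinAt) continuousOn_id
      fun r hr => (ne_of_gt hr))
  -- the remainder after subtracting the particular solution `K`
  have hrem : ∀ r, 0 < r → Tendsto (fun n => (U n r - K r) - (U n 1 - K 1)
      - (V n 1 - H 1) * Real.log r) atTop (𝓝 0) := by
    intro r hr
    set a := min r 1 with ha
    set b := max r 1 with hb
    have ha0 : 0 < a := lt_min hr one_pos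
    have hab : a ≤ b := (min_le_left _ _).trans (le_max_left _ _)
    have hrI : r ∈ Icc a b := ⟨min_le_left _ _, le_max_left _ _⟩
    have h1I : (1:ℝ) ∈ Icc a b := ⟨min_le_right _ _, le_max_right _ _⟩
    have hpos : ∀ x ∈ Icc a b, 0 < x := fun x hx => ha0.trans_le hx.1
    have hlen : ∀ x ∈ Icc a b, ∀ y ∈ Icc a b, |x - y| ≤ b - a := fun x hx y hy =>
      abs_le.2 ⟨by linarith [hx.1, hy.2], by linarith [hx.2, hy.1]⟩
    rw [Metric.tendsto_nhds]
    intro ε hε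
    have hε' : 0 < ε / ((b - a) * (b - a) / a + 1) := by
      have : 0 ≤ (b - a) * (b - a) / a := div_nonneg (mul_self_nonneg _) ha0.le
      positivity
    filter_upwards [hh a b ha0 _ hε'] with n hn
    set ε' := ε / ((b - a) * (b - a) / a + 1) with hε'def
    have m1 : ∀ x ∈ Icc a b, |x * V n x - H x - (1 * V n 1 - H 1)| ≤ ε' * (b - a) := by
      intro x hx
      refine (Convex.norm_image_sub_le_of_norm_hasDerivWithin_le (C := ε')
        (f := fun x => x * V n x - H x) (f' := fun x => h n x - f x)
        (fun y hy => ((hV n y (hpos y hy)).sub (hH y (hpos y hy))).hasDerivWithinAt)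
        (fun y hy => hn y hy) (convex_Icc a b) h1I hx).trans ?_
      gcongr
      exact hlen x hx 1 h1I
    have m2 : |(U n r - K r - (V n 1 - H 1) * Real.log r)
        - (U n 1 - K 1 - (V n 1 - H 1) * Real.log 1)| ≤ ε' * (b - a) / a * (b - a) := by
      refine (Convex.norm_image_sub_le_of_norm_hasDerivWithin_le (C := ε' * (b - a) / a)
        (f := fun x => U n x - K x - (V n 1 - H 1) * Real.log x)
        (f' := fun x => V n x - H x / x - (V n 1 - H 1) * x⁻¹)
        (fun y hy => (((hU n y (hpos y hy)).sub (hK y (hpos y hy))).sub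
          ((Real.hasDerivAt_log (hpos y hy).ne').const_mul _)).hasDerivWithinAt)
        (fun y hy => ?_) (convex_Icc a b) h1I hrI).trans ?_
      · have hy0 := hpos y hy
        have e : V n y - H y / y - (V n 1 - H 1) * y⁻¹
            = (y * V n y - H y - (1 * V n 1 - H 1)) / y := by field_simp
        rw [e, Real.norm_eq_abs, abs_div, abs_of_pos hy0]
        have := sub_nonneg.2 hab
        have := m1 y hy
        have := hy.1
        gcongr
      · have := sub_nonneg.2 hab
        gcongr
        exact hlen r hrI 1 h1I
    rw [Real.log_one, mul_zero, sub_zero] at m2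
    rw [Real.dist_eq, sub_zero]
    have e : U n r - K r - (U n 1 - K 1) - (V n 1 - H 1) * Real.log r
        = (U n r - K r - (V n 1 - H 1) * Real.log r) - (U n 1 - K 1) := by ring
    rw [e]
    refine m2.trans_lt ?_
    have hX : 0 ≤ (b - a) * (b - a) / a := div_nonneg (mul_self_nonneg _) ha0.le
    have e2 : ε' * (b - a) / a * (b - a) = ε * (((b - a) * (b - a) / a) /
        ((b - a) * (b - a) / a + 1)) := by
      rw [hε'def]; ring
    rw [e2]
    have : ((b - a) * (b - a) / a) / ((b - a) * (b - a) / a + 1) < 1 :=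
      (div_lt_one (by linarith)).2 (by linarith)
    nlinarith
  have hlog2 : Real.log 2 ≠ 0 := (Real.log_pos one_lt_two).ne'
  set z := ((u 2 - K 2) - (u 1 - K 1)) / Real.log 2 with hz
  have hzlim : Tendsto (fun n => V n 1 - H 1) atTop (𝓝 z) := by
    have h1 := ((((hu 2 two_pos).sub_const (K 2)).sub ((hu 1 one_pos).sub_const (K 1))).sub
      (hrem 2 two_pos)).div_const (Real.log 2)
    rw [sub_zero] at h1
    refine h1.congr fun n => ?_
    field_simp
    ring
  have hform : ∀ r, 0 < r → u r = K r + (u 1 - K 1) + z * Real.log r := by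
    intro r hr
    have h1 := (((hu r hr).sub_const (K r)).sub ((hu 1 one_pos).sub_const (K 1))).sub
      (hzlim.mul_const (Real.log r))
    have := tendsto_nhds_unique h1 (hrem r hr)
    linarith
  refine ⟨fun r => H r / r + z * r⁻¹, fun r hr => ⟨?_, ?_⟩⟩
  · have h1 := ((hK r hr).add_const (u 1 - K 1)).add
      ((Real.hasDerivAt_log hr.ne').const_mul z)
    refine h1.congr_of_eventuallyEq ?_
    filter_upwards [isOpen_Ioi.mem_nhds hr] with x hx using hform x hx
  · refine ((hH r hr).add_const z).congr_of_eventuallyEq ?_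
    filter_upwards [isOpen_Ioi.mem_nhds hr] with x hx
    have hx : x ≠ 0 := (ne_of_gt hx)
    field_simp

/-- Continuous functions preserve uniform smallness of differences on bounded sets. -/
lemma exists_modulus {f : ℝ → ℝ} (hf : Continuous f) (M : ℝ) {ε : ℝ} (hε : 0 < ε) :
    ∃ η > 0, ∀ x y, |x| ≤ M → |y| ≤ M → |x - y| ≤ η → |f x - f y| ≤ ε := by
  have h := isCompact_Icc.uniformContinuousOn_of_continuous (s := Icc (-M) M) hf.continuousOn
  rw [Metric.uniformContinuousOn_iff] at h
  obtain ⟨δ, hδ, h⟩ := h ε hε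
  refine ⟨δ / 2, by linarith, fun x y hx hy hxy => ?_⟩
  have := h x (abs_le.1 hx) y (abs_le.1 hy) (by rw [Real.dist_eq]; linarith)
  rw [Real.dist_eq] at this
  exact this.le

section Limit

variable {A : ℝ} {f Q : ℝ → ℝ} {ψ m : ℕ → ℝ → ℝ → ℝ}

/-- A time-independent locally uniform limit of wave maps solves the harmonic map equation. -/
lemma harmonic_of_tendsto (hA : 0 < A) (hf : Continuous f)
    (hψ : ∀ n, SlabC2 A (ψ n) (pdt (ψ n)) (pdr (ψ n)) (pdtt (ψ n)) (m n) (pdrr (ψ n)))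
    (heq : ∀ n, ∀ t ∈ Ioo (-A) A, ∀ r, 0 < r →
      pdtt (ψ n) t r - pdrr (ψ n) t r - pdr (ψ n) t r / r + f (ψ n t r) / r ^ 2 = 0)
    (hQ : ContinuousOn Q (Ioi 0))
    (hconv : ∀ a b, 0 < a → ∀ ε > 0, ∀ᶠ n in atTop, ∀ t ∈ Ioo (-A) A, ∀ r ∈ Icc a b,
      |ψ n t r - Q r| ≤ ε)
    (hfconv : ∀ a b, 0 < a → ∀ ε > 0, ∀ᶠ n in atTop, ∀ t ∈ Ioo (-A) A, ∀ r ∈ Icc a b,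
      |f (ψ n t r) - f (Q r)| ≤ ε) :
    ∃ Q' : ℝ → ℝ, ∀ r, 0 < r → HasDerivAt Q (Q' r) r ∧
      HasDerivAt (fun r => r * Q' r) (f (Q r) / r) r := by
  set B := A / 2 with hB
  have hB0 : 0 < B := by positivity
  have hBB : -B ≤ B := by linarith
  have hsub : Icc (-B) B ⊆ Ioo (-A) A := fun t ht => ⟨by linarith [ht.1], by linarith [ht.2]⟩
  have hsub' : uIcc (-B) B ⊆ Ioo (-A) A := by rwa [uIcc_of_le hBB]
  set c := ∫ t in (-B)..B, (B ^ 2 - t ^ 2) ^ 2 with hc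
  have hc0 : 0 < c := by
    refine intervalIntegral.intervalIntegral_pos_of_pos_on
      (Continuous.intervalIntegrable (by fun_prop) _ _) (fun t ht => ?_) (by linarith)
    have : t ^ 2 < B ^ 2 := sq_lt_sq' ht.1 ht.2
    have : 0 < B ^ 2 - t ^ 2 := by linarith
    positivity
  have hη0 : ∀ t ∈ Icc (-B) B, (B ^ 2 - t ^ 2) ^ 2 ≤ B ^ 4 := fun t ht => by
    have : t ^ 2 ≤ B ^ 2 := sq_le_sq' ht.1 ht.2
    nlinarith [sq_nonneg t]
  have hη2 : ∀ t ∈ Icc (-B) B, |12 * t ^ 2 - 4 * B ^ 2| ≤ 12 * B ^ 2 := fun t ht => by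
    have : t ^ 2 ≤ B ^ 2 := sq_le_sq' ht.1 ht.2
    rw [abs_le]
    constructor <;> nlinarith [sq_nonneg t, sq_nonneg B]
  have hpar := radial_ode_of_tendsto (u := fun r => c * Q r) (f := fun r => c * (f (Q r) / r))
    (U := fun n r => ∫ t in (-B)..B, (B ^ 2 - t ^ 2) ^ 2 * ψ n t r)
    (V := fun n r => ∫ t in (-B)..B, (B ^ 2 - t ^ 2) ^ 2 * pdr (ψ n) t r)
    (h := fun n r => ∫ t in (-B)..B, (B ^ 2 - t ^ 2) ^ 2 * (pdr (ψ n) t r + r * pdrr (ψ n) t r))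
    ?_ ?_ ?_ ?_ ?_
  · obtain ⟨v, hv⟩ := hpar
    refine ⟨fun r => v r / c, fun r hr => ⟨?_, ?_⟩⟩
    · have := (hv r hr).1.div_const c
      refine this.congr_of_eventuallyEq (Eventually.of_forall fun x => ?_)
      field_simp
    · have := (hv r hr).2.div_const c
      refine (this.congr_of_eventuallyEq (Eventually.of_forall fun x => ?_)).congr_deriv ?_
      · ring
      · field_simp
  · intro n r hr
    have c := (hψ n).c
    have cr := (hψ n).cr
    unfold SlabCont at c cr
    exact SlabCont.hasDerivAt_integral_space (A := A)
      (u := fun t r => (B ^ 2 - t ^ 2) ^ 2 * ψ n t r)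
      (ur := fun t r => (B ^ 2 - t ^ 2) ^ 2 * pdr (ψ n) t r)
      (by unfold SlabCont; fun_prop) (by unfold SlabCont; fun_prop)
      (fun t ht r hr => ((hψ n).dr t ht r hr).const_mul _) hsub' hr
  · intro n r hr
    have crr := (hψ n).crr
    have cr := (hψ n).cr
    unfold SlabCont at crr cr
    have := SlabCont.hasDerivAt_integral_space (A := A)
      (u := fun t r => (B ^ 2 - t ^ 2) ^ 2 * (r * pdr (ψ n) t r))
      (ur := fun t r => (B ^ 2 - t ^ 2) ^ 2 * (pdr (ψ n) t r + r * pdrr (ψ n) t r))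
      (by unfold SlabCont; fun_prop) (by unfold SlabCont; fun_prop)
      (fun t ht r hr => (((hasDerivAt_id r).mul ((hψ n).drr t ht r hr)).const_mul _).congr_deriv
        (by simp)) hsub' hr
    refine this.congr_of_eventuallyEq (Eventually.of_forall fun x => ?_)
    simp only
    rw [← intervalIntegral.integral_const_mul]
    congr 1; ext t; ring
  · intro r hr
    rw [Metric.tendsto_nhds]
    intro ε hε
    have hD : 0 < B ^ 4 * (2 * B) := by positivity
    filter_upwards [hconv r r hr (ε / 2 / (B ^ 4 * (2 * B))) (by positivity)] with n hn
    have hcs : ContinuousOn (fun t => ψ n t r) (Icc (-B) B) := ((hψ n).c.slice_time hr).mono hsub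
    rw [Real.dist_eq, hc, ← intervalIntegral.integral_mul_const, ← intervalIntegral.integral_sub]
    · have := intervalIntegral.norm_integral_le_of_norm_le_const (a := -B) (b := B)
        (f := fun t => (B ^ 2 - t ^ 2) ^ 2 * ψ n t r - (B ^ 2 - t ^ 2) ^ 2 * Q r)
        (C := B ^ 4 * (ε / 2 / (B ^ 4 * (2 * B)))) (fun t ht => by
          rw [uIoc_of_le hBB] at ht
          have ht : t ∈ Icc (-B) B := ⟨ht.1.le, ht.2⟩
          rw [← mul_sub, Real.norm_eq_abs, abs_mul, abs_of_nonneg (sq_nonneg _)]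
          have := hn t (hsub ht) r ⟨le_rfl, le_rfl⟩
          have := hη0 t ht
          gcongr)
      refine lt_of_le_of_lt this ?_
      have e : |B - -B| = 2 * B := by rw [abs_of_pos (by linarith)]; ring
      rw [e]
      have : B ^ 4 * (ε / 2 / (B ^ 4 * (2 * B))) * (2 * B) = ε / 2 := by field_simp
      linarith
    · exact ContinuousOn.intervalIntegrable_of_Icc hBB (by fun_prop)
    · exact Continuous.intervalIntegrable (by fun_prop) _ _
  · exact continuousOn_const.mul ((hf.comp_continuousOn hQ).div continuousOn_id
      fun r hr => ne_of_gt hr)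
  · intro a b ha ε hε
    by_cases hab : a ≤ b
    swap
    · exact Eventually.of_forall fun n r hr => absurd (hr.1.trans hr.2) hab
    have hb0 : 0 < b := ha.trans_le hab
    set D := (12 * B ^ 2 * b + B ^ 4 / a) * (2 * B) with hD
    have hD0 : 0 < D := by positivity
    filter_upwards [hconv a b ha (ε / D) (by positivity), hfconv a b ha (ε / D) (by positivity)]
      with n hn hfn r hr
    have hr0 : 0 < r := ha.trans_le hr.1
    have s0 : ContinuousOn (fun t => ψ n t r) (Icc (-B) B) := ((hψ n).c.slice_time hr0).mono hsub
    have sf : ContinuousOn (fun t => f (ψ n t r)) (Icc (-B) B) := hf.comp_continuousOn s0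
    have st : ContinuousOn (fun t => pdt (ψ n) t r) (Icc (-B) B) :=
      ((hψ n).ct.slice_time hr0).mono hsub
    have stt : ContinuousOn (fun t => pdtt (ψ n) t r) (Icc (-B) B) :=
      ((hψ n).ctt.slice_time hr0).mono hsub
    have sr : ContinuousOn (fun t => pdr (ψ n) t r) (Icc (-B) B) :=
      ((hψ n).cr.slice_time hr0).mono hsub
    have srr : ContinuousOn (fun t => pdrr (ψ n) t r) (Icc (-B) B) :=
      ((hψ n).crr.slice_time hr0).mono hsub
    -- two integrations by parts in time
    have hibp : ∫ t in (-B)..B, (r * ((B ^ 2 - t ^ 2) ^ 2 * pdtt (ψ n) t r)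
        - r * ((12 * t ^ 2 - 4 * B ^ 2) * (ψ n t r - Q r))) = 0 := by
      have := intervalIntegral.integral_eq_sub_of_hasDerivAt (a := -B) (b := B)
        (f := fun t => r * ((B ^ 2 - t ^ 2) ^ 2 * pdt (ψ n) t r)
          - r * ((-4 * t * (B ^ 2 - t ^ 2)) * (ψ n t r - Q r)))
        (f' := fun t => r * ((B ^ 2 - t ^ 2) ^ 2 * pdtt (ψ n) t r)
          - r * ((12 * t ^ 2 - 4 * B ^ 2) * (ψ n t r - Q r))) ?_ ?_
      · rw [this]; ring
      · intro t ht
        have ht := hsub' ht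
        have d0 : HasDerivAt (fun t : ℝ => B ^ 2 - t ^ 2) (-(2 * t)) t := by
          have := ((hasDerivAt_id t).pow 2).const_sub (B ^ 2)
          simpa using this
        have d1 := ((d0.pow 2).mul ((hψ n).dtt t ht r hr0)).const_mul r
        have d2 := ((((hasDerivAt_id t).const_mul (-4)).mul d0).mul
          (((hψ n).dt t ht r hr0).sub_const (Q r))).const_mul r
        refine (d1.sub d2).congr_deriv ?_
        simp only [Pi.mul_apply, id]
        push_cast
        simp
        ring
      · exact ContinuousOn.intervalIntegrable_of_Icc hBB (by fun_prop)
    have hid : (∫ t in (-B)..B, (B ^ 2 - t ^ 2) ^ 2 * (pdr (ψ n) t r + r * pdrr (ψ n) t r))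
        - c * (f (Q r) / r) = ∫ t in (-B)..B, (r * ((12 * t ^ 2 - 4 * B ^ 2) * (ψ n t r - Q r))
          + (B ^ 2 - t ^ 2) ^ 2 * (f (ψ n t r) - f (Q r)) / r) := by
      rw [hc, ← intervalIntegral.integral_mul_const, ← intervalIntegral.integral_sub,
        ← sub_eq_zero, ← intervalIntegral.integral_sub, ← hibp]
      · refine intervalIntegral.integral_congr fun t ht => ?_
        have := heq n t (hsub' ht) r hr0
        have e : pdrr (ψ n) t r = pdtt (ψ n) t r - pdr (ψ n) t r / r + f (ψ n t r) / r ^ 2 := by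
          linarith
        simp only [e]
        field_simp
        ring
      · exact ContinuousOn.intervalIntegrable_of_Icc hBB (by fun_prop)
      · exact ContinuousOn.intervalIntegrable_of_Icc hBB
          (by simp only [div_eq_mul_inv]; fun_prop)
      · exact ContinuousOn.intervalIntegrable_of_Icc hBB (by fun_prop)
      · exact Continuous.intervalIntegrable (by fun_prop) _ _
    rw [hid]
    have := intervalIntegral.norm_integral_le_of_norm_le_const (a := -B) (b := B)
      (f := fun t => (r * ((12 * t ^ 2 - 4 * B ^ 2) * (ψ n t r - Q r))
          + (B ^ 2 - t ^ 2) ^ 2 * (f (ψ n t r) - f (Q r)) / r))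
      (C := (12 * B ^ 2 * b + B ^ 4 / a) * (ε / D)) (fun t ht => by
        rw [uIoc_of_le hBB] at ht
        have ht : t ∈ Icc (-B) B := ⟨ht.1.le, ht.2⟩
        have b1 := hn t (hsub ht) r hr
        have b2 := hfn t (hsub ht) r hr
        have b3 := hη0 t ht
        have b4 := hη2 t ht
        have b5 := hr.1
        have b6 := hr.2
        calc _ ≤ |r * ((12 * t ^ 2 - 4 * B ^ 2) * (ψ n t r - Q r))|
              + |(B ^ 2 - t ^ 2) ^ 2 * (f (ψ n t r) - f (Q r)) / r| := abs_add_le _ _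
          _ = r * (|12 * t ^ 2 - 4 * B ^ 2| * |ψ n t r - Q r|)
              + (B ^ 2 - t ^ 2) ^ 2 * |f (ψ n t r) - f (Q r)| / r := by
            rw [abs_mul, abs_mul, abs_div, abs_mul, abs_of_pos hr0,
              abs_of_nonneg (sq_nonneg (B ^ 2 - t ^ 2))]
          _ ≤ b * (12 * B ^ 2 * (ε / D)) + B ^ 4 * (ε / D) / a := by gcongr
          _ = _ := by ring)
    refine this.trans (le_of_eq ?_)
    have e : |B - -B| = 2 * B := by rw [abs_of_pos (by linarith)]; ring
    rw [e]
    calc _ = D * (ε / D) := by rw [hD]; ring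
      _ = ε := by field_simp

end Limit

/-- A sequence of wave maps on `[-A, A]` with energies at most `E`, uniformly bounded by `M`,
whose space-time kinetic energy on the balls of radius `ρ n → ∞` tends to zero. -/
structure WaveMapSeq (g : ℝ → ℝ) (A E M : ℝ) (ψ : ℕ → ℝ → ℝ → ℝ) (ρ : ℕ → ℝ) : Prop where
  cont : Continuous g
  time_pos : 0 < A
  energy_pos : 0 < E
  wave : ∀ n, IsWaveMapOn g (ψ n) (Icc (-A) A)
  energy_le : ∀ n, ∀ t ∈ Icc (-A) A,
    energyOn g (ψ n t) (pdt (ψ n) t) (Ioi 0) ≤ ENNReal.ofReal E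
  bound : ∀ n, ∀ t ∈ Ioo (-A) A, ∀ r, 0 < r → |ψ n t r| ≤ M
  radius : Tendsto ρ atTop atTop
  kinetic : Tendsto (fun n => ∫⁻ t in Icc (-A) A, ∫⁻ r in Ioo 0 (ρ n),
        ENNReal.ofReal ((pdt (ψ n) t r) ^ 2 * r)) atTop (𝓝 0)

lemma exists_uniform_bound {g : ℝ → ℝ} (hg : Continuous g) (hA1 : A1 g) {A E : ℝ} (hE : 0 ≤ E)
    {ψ : ℕ → ℝ → ℝ → ℝ} (hwm : ∀ n, IsWaveMapOn g (ψ n) (Icc (-A) A))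
    (hen : ∀ n, ∀ t ∈ Icc (-A) A, energyOn g (ψ n t) (pdt (ψ n) t) (Ioi 0) ≤ ENNReal.ofReal E)
    {ℓ : ℕ → ℝ} (hlim : ∀ n, ∀ t ∈ Icc (-A) A, Tendsto (ψ n t) (𝓝[>] (0:ℝ)) (𝓝 (ℓ n)))
    (hbdd : ∃ M : ℝ, ∀ n, |ℓ n| ≤ M) :
    ∃ M, ∀ n, ∀ t ∈ Ioo (-A) A, ∀ r, 0 < r → |ψ n t r| ≤ M := by
  have hG : Continuous (Gfun g) :=
    continuous_iff_continuousAt.2 fun x => (hasDerivAt_Gfun hg x).continuousAt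
  obtain ⟨M₀, hM₀⟩ := hbdd
  obtain ⟨C, hC⟩ := (isCompact_Icc (a := -M₀) (b := M₀)).exists_bound_of_continuousOn
    hG.continuousOn
  obtain ⟨M, -, hM⟩ := exists_bound_of_Gfun_bound hA1 (C + E)
  refine ⟨M, fun n t ht r hr => hM _ ?_⟩
  obtain ⟨m, hm⟩ := SlabC2.of_contDiffOn (hwm n).1
  have h1 := hm.abs_Gfun_sub_limit_le hg hE (hen n) ht (hlim n t (Ioo_subset_Icc_self ht)) hr
  have h2 : |Gfun g (ℓ n)| ≤ C := hC _ (abs_le.1 (hM₀ n))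
  calc |Gfun g (ψ n t r)| = |Gfun g (ℓ n) + (Gfun g (ψ n t r) - Gfun g (ℓ n))| := by ring_nf
    _ ≤ C + E := (abs_add_le _ _).trans (add_le_add h2 h1)

namespace WaveMapSeq

variable {g : ℝ → ℝ} {A E M : ℝ} {ψ : ℕ → ℝ → ℝ → ℝ} {ρ : ℕ → ℝ}

lemma subseq (h : WaveMapSeq g A E M ψ ρ) {σ : ℕ → ℕ} (hσ : StrictMono σ) :
    WaveMapSeq g A E M (fun n => ψ (σ n)) (fun n => ρ (σ n)) where
  cont := h.cont
  time_pos := h.time_pos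
  energy_pos := h.energy_pos
  wave n := h.wave (σ n)
  energy_le n := h.energy_le (σ n)
  bound n := h.bound (σ n)
  radius := h.radius.comp hσ.tendsto_atTop
  kinetic := h.kinetic.comp hσ.tendsto_atTop

lemma slab (h : WaveMapSeq g A E M ψ ρ) (n : ℕ) :
    ∃ m, SlabC2 A (ψ n) (pdt (ψ n)) (pdr (ψ n)) (pdtt (ψ n)) m (pdrr (ψ n)) :=
  SlabC2.of_contDiffOn (h.wave n).1

lemma zero_mem (h : WaveMapSeq g A E M ψ ρ) : (0 : ℝ) ∈ Ioo (-A) A :=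
  ⟨neg_lt_zero.2 h.time_pos, h.time_pos⟩

lemma equicontinuous (h : WaveMapSeq g A E M ψ ρ) (a b : ℝ) (ha : 0 < a) (ε : ℝ) (hε : 0 < ε) :
    ∃ η > 0, ∀ n, ∀ r ∈ Icc a b, ∀ s ∈ Icc a b, |r - s| < η → |ψ n 0 r - ψ n 0 s| ≤ ε := by
  have hE := h.energy_pos
  set lam := ε / (2 * E) with hlam
  have hlam0 : 0 < lam := by positivity
  have key : ∀ n, ∀ r ∈ Icc a b, ∀ s ∈ Icc a b, s ≤ r → |r - s| < ε / 2 * (lam * a) →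
      |ψ n 0 r - ψ n 0 s| ≤ ε := by
    intro n r hr s hs hsr hrs
    obtain ⟨m, hm⟩ := h.slab n
    have hs0 : 0 < s := ha.trans_le hs.1
    have hsub : Icc s r ⊆ Ioi 0 := fun x hx => hs0.trans_le hx.1
    have h1 := abs_sub_le_of_radial_energy hs0 hsr hlam0
      (fun x hx => hm.dr 0 h.zero_mem x (hsub hx)) ((hm.cr.slice h.zero_mem).mono hsub)
      (hm.integral_pdr_le h.cont hE.le (h.energy_le n) hs0 hsr h.zero_mem)
    rw [abs_of_nonneg (by linarith)] at hrs
    have h2 : (r - s) / (lam * s) ≤ ε / 2 := by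
      rw [div_le_iff₀ (by positivity)]
      refine hrs.le.trans ?_
      have := hs.1
      gcongr
    have h3 : lam * E = ε / 2 := by rw [hlam]; field_simp
    linarith
  refine ⟨ε / 2 * (lam * a), by positivity, fun n r hr s hs hrs => ?_⟩
  rcases le_total s r with hsr | hsr
  · exact key n r hr s hs hsr hrs
  · rw [abs_sub_comm]
    exact key n s hs r hr hsr (by rwa [abs_sub_comm])

lemma eventually_kinetic_primitive (h : WaveMapSeq g A E M ψ ρ) {a b : ℝ} (ha : 0 < a)
    (hab : a ≤ b) {κ : ℝ} (hκ : 0 < κ) : ∀ᶠ n in atTop, ∃ P : ℝ → ℝ,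
      (∀ t ∈ Ioo (-A) A, HasDerivAt P (∫ r in a..b, pdt (ψ n) t r ^ 2 * r) t) ∧
      ∀ t ∈ Ioo (-A) A, |P t| ≤ κ := by
  filter_upwards [h.radius.eventually_gt_atTop b,
    h.kinetic.eventually_le_const (ENNReal.ofReal_pos.2 hκ)] with n h1 h2
  obtain ⟨m, hm⟩ := h.slab n
  exact hm.exists_kinetic_primitive h.time_pos ha hab h1 hκ.le h2

lemma eventually_abs_sub_time_le (h : WaveMapSeq g A E M ψ ρ) {a b : ℝ} (ha : 0 < a)
    {ε : ℝ} (hε : 0 < ε) : ∀ᶠ n in atTop, ∀ t ∈ Ioo (-A) A, ∀ s ∈ Ioo (-A) A,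
      ∀ r ∈ Icc a b, |ψ n t r - ψ n s r| ≤ ε := by
  by_cases hab : a ≤ b
  swap
  · exact Eventually.of_forall fun n t _ s _ r hr => absurd (hr.1.trans hr.2) hab
  have hE := h.energy_pos
  have hA := h.time_pos
  set lam := ε / (8 * E) with hlam
  have hlam0 : 0 < lam := by positivity
  set d := min 1 (ε / 8 * (lam * a)) with hd
  have hd0 : 0 < d := by positivity
  set δ := (ε / 2) / (2 * A + 2 / (a * d)) with hδ
  have hδ0 : 0 < δ := by positivity
  filter_upwards [h.eventually_kinetic_primitive (b := b + 1) ha (by linarith)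
    (pow_pos hδ0 2)] with n ⟨P, hP, hPb⟩ t ht s hs r hr
  obtain ⟨m, hm⟩ := h.slab n
  have h1 := hm.abs_sub_time_le ha hd0 (min_le_left _ _) hlam0 hδ0
    (fun t ht => hm.integral_pdr_le h.cont hE.le (h.energy_le n) ha (by linarith) ht) hP hPb hr hs ht
  have h2 : d / (lam * a) ≤ ε / 8 := by
    rw [div_le_iff₀ (by positivity)]
    exact min_le_right _ _
  have h3 : lam * E = ε / 8 := by rw [hlam]; field_simp
  have h4 : (2 * A + 2 / (a * d)) * δ = ε / 2 := by rw [hδ]; field_simp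
  linarith

/-- Locally uniform convergence, along a subsequence, to a time-independent limit. -/
lemma exists_limit (h : WaveMapSeq g A E M ψ ρ) : ∃ σ : ℕ → ℕ, StrictMono σ ∧ ∃ Q : ℝ → ℝ,
    ∀ a b, 0 < a → ∀ ε > 0, ∀ᶠ n in atTop, ∀ t ∈ Ioo (-A) A, ∀ r ∈ Icc a b,
      |ψ (σ n) t r - Q r| ≤ ε := by
  obtain ⟨σ, hσ, Q, hQ⟩ := exists_subseq_tendsto_locally_uniformly (q := fun n => ψ n 0)
    (fun n => h.bound n 0 h.zero_mem) h.equicontinuous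
  refine ⟨σ, hσ, Q, fun a b ha ε hε => ?_⟩
  filter_upwards [hQ a b ha (ε / 2) (by positivity),
    (h.subseq hσ).eventually_abs_sub_time_le (b := b) ha (half_pos hε)] with n h1 h2 t ht r hr
  have := abs_sub_le (ψ (σ n) t r) (ψ (σ n) 0 r) (Q r)
  have := h1 r hr
  have := h2 t ht 0 h.zero_mem r hr
  linarith

section Limit

variable {Q : ℝ → ℝ}

lemma tendsto_limit (h : WaveMapSeq g A E M ψ ρ)
    (hconv : ∀ a b, 0 < a → ∀ ε > 0, ∀ᶠ n in atTop, ∀ t ∈ Ioo (-A) A, ∀ r ∈ Icc a b,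
      |ψ n t r - Q r| ≤ ε) {r : ℝ} (hr : 0 < r) :
    Tendsto (fun n => ψ n 0 r) atTop (𝓝 (Q r)) := by
  refine Metric.tendsto_nhds.2 fun ε hε => ?_
  filter_upwards [hconv r r hr (ε / 2) (by positivity)] with n hn
  have := hn 0 h.zero_mem r ⟨le_rfl, le_rfl⟩
  rw [Real.dist_eq]
  linarith

lemma abs_limit_le (h : WaveMapSeq g A E M ψ ρ)
    (hconv : ∀ a b, 0 < a → ∀ ε > 0, ∀ᶠ n in atTop, ∀ t ∈ Ioo (-A) A, ∀ r ∈ Icc a b,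
      |ψ n t r - Q r| ≤ ε) {r : ℝ} (hr : 0 < r) : |Q r| ≤ M :=
  le_of_tendsto (h.tendsto_limit hconv hr).abs
    (Eventually.of_forall fun n => h.bound n 0 h.zero_mem r hr)

lemma continuousOn_limit (h : WaveMapSeq g A E M ψ ρ)
    (hconv : ∀ a b, 0 < a → ∀ ε > 0, ∀ᶠ n in atTop, ∀ t ∈ Ioo (-A) A, ∀ r ∈ Icc a b,
      |ψ n t r - Q r| ≤ ε) : ContinuousOn Q (Ioi 0) := by
  refine TendstoLocallyUniformlyOn.continuousOn (F := fun n => ψ n 0) (p := atTop) ?_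
    (Eventually.of_forall fun n => ?_).frequently
  · refine Metric.tendstoLocallyUniformlyOn_iff.2 fun ε hε r hr => ?_
    have hr : 0 < r := hr
    refine ⟨Icc (r / 2) (2 * r), mem_nhdsWithin_of_mem_nhds
      (Icc_mem_nhds (by linarith) (by linarith)), ?_⟩
    filter_upwards [hconv (r / 2) (2 * r) (by positivity) (ε / 2) (by positivity)] with n hn s hs
    have := hn 0 h.zero_mem s hs
    rw [dist_comm, Real.dist_eq]
    linarith
  · obtain ⟨m, hm⟩ := h.slab n
    exact hm.c.slice h.zero_mem

lemma eventually_comp_le (h : WaveMapSeq g A E M ψ ρ)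
    (hconv : ∀ a b, 0 < a → ∀ ε > 0, ∀ᶠ n in atTop, ∀ t ∈ Ioo (-A) A, ∀ r ∈ Icc a b,
      |ψ n t r - Q r| ≤ ε) {f : ℝ → ℝ} (hf : Continuous f) (a b : ℝ) (ha : 0 < a)
    (ε : ℝ) (hε : 0 < ε) : ∀ᶠ n in atTop, ∀ t ∈ Ioo (-A) A, ∀ r ∈ Icc a b,
      |f (ψ n t r) - f (Q r)| ≤ ε := by
  obtain ⟨η, hη, hmod⟩ := exists_modulus hf M hε
  filter_upwards [hconv a b ha η hη] with n hn t ht r hr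
  have hr0 := ha.trans_le hr.1
  exact hmod _ _ (h.bound n t ht r hr0) (h.abs_limit_le hconv hr0) (hn t ht r hr)

lemma harmonic_limit (h : WaveMapSeq g A E M ψ ρ) (hg' : Continuous (deriv g))
    (hconv : ∀ a b, 0 < a → ∀ ε > 0, ∀ᶠ n in atTop, ∀ t ∈ Ioo (-A) A, ∀ r ∈ Icc a b,
      |ψ n t r - Q r| ≤ ε) :
    ∃ Q' : ℝ → ℝ, ∀ r, 0 < r → HasDerivAt Q (Q' r) r ∧
      HasDerivAt (fun r => r * Q' r) (g (Q r) * deriv g (Q r) / r) r := by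
  choose m hm using h.slab
  exact harmonic_of_tendsto (f := fun x => g x * deriv g x) h.time_pos (h.cont.mul hg') hm
    (fun n t ht r hr => (h.wave n).2 t (Ioo_subset_Icc_self ht) r hr)
    (h.continuousOn_limit hconv) hconv (h.eventually_comp_le hconv (h.cont.mul hg'))

end Limit

end WaveMapSeq

lemma hasDerivAt_of_mul_id {Q' F : ℝ → ℝ} {r : ℝ} (hr : 0 < r)
    (h : HasDerivAt (fun r => r * Q' r) (F r / r) r) :
    HasDerivAt Q' ((F r / r - Q' r) / r) r := by
  have h1 := h.div (hasDerivAt_id r) hr.ne'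
  have h2 : HasDerivAt (fun s => s * Q' s / s) ((F r / r - Q' r) / r) r := by
    refine h1.congr_deriv ?_
    simp only [id]
    field_simp
  refine h2.congr_of_eventuallyEq ?_
  filter_upwards [Ioi_mem_nhds hr] with s hs
  have : s ≠ 0 := ne_of_gt hs
  field_simp

lemma SlabC2.sub_static {A : ℝ} {w wt wr wtt wtr wrr : ℝ → ℝ → ℝ}
    (h : SlabC2 A w wt wr wtt wtr wrr) {Q Q' Q'' : ℝ → ℝ}
    (hQ : ∀ r, 0 < r → HasDerivAt Q (Q' r) r) (hQ' : ∀ r, 0 < r → HasDerivAt Q' (Q'' r) r)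
    (hQ'' : ContinuousOn Q'' (Ioi 0)) :
    SlabC2 A (fun t r => w t r - Q r) wt (fun t r => wr t r - Q' r) wtt wtr
      (fun t r => wrr t r - Q'' r) := by
  have hs : ∀ u : ℝ → ℝ, ContinuousOn u (Ioi 0) →
      ContinuousOn (fun p : ℝ × ℝ => u p.2) (Ioo (-A) A ×ˢ Ioi 0) := fun u hu =>
    hu.comp continuousOn_snd fun p hp => hp.2
  have c0 : ContinuousOn Q (Ioi 0) := fun r hr => (hQ r hr).continuousAt.continuousWithinAt
  have c1 : ContinuousOn Q' (Ioi 0) := fun r hr => (hQ' r hr).continuousAt.continuousWithinAt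
  exact
  { dt := fun t ht r hr => (h.dt t ht r hr).sub_const _
    dr := fun t ht r hr => (h.dr t ht r hr).sub (hQ r hr)
    dtt := h.dtt
    dtr := fun t ht r hr => (h.dtr t ht r hr).sub_const _
    drt := h.drt
    drr := fun t ht r hr => (h.drr t ht r hr).sub (hQ' r hr)
    c := h.c.sub (hs _ c0)
    ct := h.ct
    cr := h.cr.sub (hs _ c1)
    ctt := h.ctt
    ctr := h.ctr
    crr := h.crr.sub (hs _ hQ'') }

namespace WaveMapSeq

variable {g : ℝ → ℝ} {A E M : ℝ} {ψ : ℕ → ℝ → ℝ → ℝ} {ρ : ℕ → ℝ} {Q Q' : ℝ → ℝ}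

lemma eventually_localized_energy_le (h : WaveMapSeq g A E M ψ ρ) (hg' : Continuous (deriv g))
    (hconv : ∀ a b, 0 < a → ∀ ε > 0, ∀ᶠ n in atTop, ∀ t ∈ Ioo (-A) A, ∀ r ∈ Icc a b,
      |ψ n t r - Q r| ≤ ε)
    (hQ : ∀ r, 0 < r → HasDerivAt Q (Q' r) r)
    (hQ' : ∀ r, 0 < r → HasDerivAt (fun r => r * Q' r) (g (Q r) * deriv g (Q r) / r) r)
    {a b ε : ℝ} (ha : 0 < a) (hab : a < b) (hε : 0 < ε) :
    ∀ᶠ n in atTop, ∀ t ∈ Ioo (-A) A, ∫ r in a..b,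
      (r - a) * (b - r) * r * (pdt (ψ n) t r ^ 2 + (pdr (ψ n) t r - Q' r) ^ 2) ≤ ε := by
  have hA := h.time_pos
  have hE := h.energy_pos
  set f : ℝ → ℝ := fun x => g x * deriv g x with hf
  have hfc : Continuous f := h.cont.mul hg'
  set Q'' : ℝ → ℝ := fun r => (f (Q r) / r - Q' r) / r with hQ''
  have hd : ∀ r, 0 < r → HasDerivAt Q' (Q'' r) r := fun r hr =>
    hasDerivAt_of_mul_id (F := fun r => f (Q r)) hr (hQ' r hr)
  have c0 : ContinuousOn Q (Ioi 0) := fun r hr => (hQ r hr).continuousAt.continuousWithinAt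
  have c1 : ContinuousOn Q' (Ioi 0) := fun r hr => (hd r hr).continuousAt.continuousWithinAt
  have c2 : ContinuousOn Q'' (Ioi 0) :=
    (((hfc.comp_continuousOn c0).div continuousOn_id fun r hr => ne_of_gt hr).sub c1).div
      continuousOn_id fun r hr => ne_of_gt hr
  have hsub : Icc a b ⊆ Ioi 0 := fun x hx => ha.trans_le hx.1
  set J := ∫ r in a..b, Q' r ^ 2 * r with hJ
  have hJ0 : 0 ≤ J := intervalIntegral.integral_nonneg hab.le fun r hr =>
    mul_nonneg (sq_nonneg _) (ha.le.trans hr.1)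
  set N := ∫ r in a..b, r with hN
  have hN0 : 0 ≤ N := intervalIntegral.integral_nonneg hab.le fun r hr => ha.le.trans hr.1
  set K := 2 * E + 2 * J with hK
  set L := (b - a) ^ 2 + (b - a) with hL
  have hba : 0 < b - a := by linarith
  set C := (L * (2 + 2 * N + K)) * ((4 + A) / A + 2 * A + 2) with hC
  have hC0 : 0 < C := by positivity
  set δ := min 1 (ε / C) with hδ
  have hδ0 : 0 < δ := by positivity
  filter_upwards [hconv a b ha δ hδ0, h.eventually_comp_le hconv hfc a b ha (δ * a ^ 2)
    (by positivity), h.eventually_kinetic_primitive ha hab.le (pow_pos hδ0 2)]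
    with n h1 h2 ⟨P, hP, hPb⟩ t ht
  obtain ⟨m, hm⟩ := h.slab n
  refine ((hm.sub_static hQ hd c2).localized_energy_le hA (K := K) (L := L) ha hab hδ0
    (min_le_left _ _) ?_ ?_ le_rfl h1 ?_ ?_ ?_ hP hPb ht).trans ?_
  · intro r hr
    have := hr.1
    have := hr.2
    nlinarith
  · intro r hr
    have := hr.1
    have := hr.2
    have : 0 ≤ (b - a) ^ 2 := sq_nonneg _
    exact abs_le.2 ⟨by linarith, by linarith⟩
  · intro t ht r hr
    have hr0 : 0 < r := hsub hr
    have e := (h.wave n).2 t (Ioo_subset_Icc_self ht) r hr0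
    have e1 : pdtt (ψ n) t r - pdrr (ψ n) t r = pdr (ψ n) t r / r - f (ψ n t r) / r ^ 2 := by
      simp only [hf]; linarith
    have e2 : r * (pdtt (ψ n) t r - (pdrr (ψ n) t r - Q'' r)) - (pdr (ψ n) t r - Q' r)
        = -(f (ψ n t r) - f (Q r)) / r := by
      rw [eq_add_of_sub_eq e1, hQ'']
      field_simp
      ring
    rw [e2, abs_div, abs_neg, abs_of_pos hr0, div_le_iff₀ hr0]
    refine (h2 t ht r hr).trans ?_
    have := hr.1
    calc δ * a ^ 2 ≤ δ * r ^ 2 := by gcongr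
      _ = δ * r * r := by ring
  · intro t ht
    have := hm.integral_pdt_le h.cont hE.le (h.energy_le n) ha hab.le ht
    linarith
  · intro t ht
    have k1 := hm.integral_pdr_le h.cont hE.le (h.energy_le n) ha hab.le ht
    have k2 := (hm.cr.slice ht).mono hsub
    have k3 := c1.mono hsub
    have k4 : ∫ r in a..b, (pdr (ψ n) t r - Q' r) ^ 2 * r
        ≤ ∫ r in a..b, (2 * (pdr (ψ n) t r ^ 2 * r) + 2 * (Q' r ^ 2 * r)) := by
      refine intervalIntegral.integral_mono_on hab.le
        (ContinuousOn.intervalIntegrable_of_Icc hab.le (by fun_prop))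
        (ContinuousOn.intervalIntegrable_of_Icc hab.le (by fun_prop)) fun r hr => ?_
      have hr0 : 0 < r := hsub hr
      have := mul_nonneg (sq_nonneg (pdr (ψ n) t r + Q' r)) hr0.le
      nlinarith
    rw [intervalIntegral.integral_add, intervalIntegral.integral_const_mul,
      intervalIntegral.integral_const_mul] at k4
    · linarith
    · exact ContinuousOn.intervalIntegrable_of_Icc hab.le (by fun_prop)
    · exact ContinuousOn.intervalIntegrable_of_Icc hab.le (by fun_prop)
  · calc C * δ ≤ C * (ε / C) := by gcongr; exact min_le_right _ _
      _ = ε := by field_simp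

/-- Convergence in `H × L²` on compact annuli, uniformly over the open time interval. -/
lemma eventually_integral_le (h : WaveMapSeq g A E M ψ ρ) (hg' : Continuous (deriv g))
    (hconv : ∀ a b, 0 < a → ∀ ε > 0, ∀ᶠ n in atTop, ∀ t ∈ Ioo (-A) A, ∀ r ∈ Icc a b,
      |ψ n t r - Q r| ≤ ε)
    (hQ : ∀ r, 0 < r → HasDerivAt Q (Q' r) r)
    (hQ' : ∀ r, 0 < r → HasDerivAt (fun r => r * Q' r) (g (Q r) * deriv g (Q r) / r) r)
    {c d ε : ℝ} (hc : 0 < c) (hcd : c ≤ d) (hε : 0 < ε) :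
    ∀ᶠ n in atTop, ∀ t ∈ Ioo (-A) A,
      ∫ r in c..d, (pdt (ψ n) t r ^ 2 + (pdr (ψ n) t r - Q' r) ^ 2
        + (ψ n t r - Q r) ^ 2 / r ^ 2) * r ≤ ε := by
  have hd : 0 < d := hc.trans_le hcd
  set η := ε / (2 * (d - c + 1)) with hη
  have hdc : 0 ≤ d - c := by linarith
  have hη0 : 0 < η := by positivity
  have hηε : η * (d - c) ≤ ε / 2 := by
    rw [hη, div_mul_eq_mul_div, div_le_iff₀ (by positivity)]
    nlinarith
  filter_upwards [h.eventually_localized_energy_le hg' hconv hQ hQ' (a := c / 2) (b := 2 * d)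
    (ε := c * d / 2 * (ε / 2)) (by positivity) (by linarith) (by positivity),
    hconv c d hc (min 1 (c * η)) (by positivity)] with n h1 h2 t ht
  obtain ⟨m, hm⟩ := h.slab n
  have hsub : Icc c d ⊆ Ioi 0 := fun x hx => hc.trans_le hx.1
  have hsub' : Icc (c / 2) (2 * d) ⊆ Ioi 0 := fun x hx => (half_pos hc).trans_le hx.1
  have c0 : ContinuousOn Q (Ioi 0) := fun r hr => (hQ r hr).continuousAt.continuousWithinAt
  have c1 : ContinuousOn Q' (Ioi 0) := fun r hr => (hasDerivAt_of_mul_id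
    (F := fun r => g (Q r) * deriv g (Q r)) hr (hQ' r hr)).continuousAt.continuousWithinAt
  have s1 := (hm.ct.slice ht).mono hsub
  have s2 := (hm.cr.slice ht).mono hsub
  have s3 := c1.mono hsub
  have s4 := ((hm.c.slice ht).mono hsub).sub (c0.mono hsub)
  have z1 := (hm.ct.slice ht).mono hsub'
  have z2 := (hm.cr.slice ht).mono hsub'
  have z3 := c1.mono hsub'
  have s5 : ContinuousOn (fun r => (pdt (ψ n) t r ^ 2 + (pdr (ψ n) t r - Q' r) ^ 2
      + (ψ n t r - Q r) ^ 2 / r ^ 2) * r) (Icc c d) :=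
    continuousOn_energy_density (g := id) continuous_id (fun r hr => hsub hr) s4 (s2.sub s3) s1
  set D : ℝ → ℝ := fun r => (r - c / 2) * (2 * d - r) * r *
    (pdt (ψ n) t r ^ 2 + (pdr (ψ n) t r - Q' r) ^ 2) with hD
  have hDc' : ContinuousOn D (Icc (c / 2) (2 * d)) := by fun_prop
  have hDc : ContinuousOn D (Icc c d) := by fun_prop
  have hle : ∫ r in c..d, (pdt (ψ n) t r ^ 2 + (pdr (ψ n) t r - Q' r) ^ 2
      + (ψ n t r - Q r) ^ 2 / r ^ 2) * r ≤ ∫ r in c..d, (2 / (c * d) * D r + η) := by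
    refine intervalIntegral.integral_mono_on hcd (s5.intervalIntegrable_of_Icc hcd)
      (ContinuousOn.intervalIntegrable_of_Icc hcd (by fun_prop)) fun r hr => ?_
    have hr0 : 0 < r := hsub hr
    have l1 : c * d / 2 ≤ (r - c / 2) * (2 * d - r) := by nlinarith [hr.1, hr.2]
    have l2 : r * (pdt (ψ n) t r ^ 2 + (pdr (ψ n) t r - Q' r) ^ 2) ≤ 2 / (c * d) * D r := by
      calc _ = 2 / (c * d) * (c * d / 2 * r *
            (pdt (ψ n) t r ^ 2 + (pdr (ψ n) t r - Q' r) ^ 2)) := by field_simp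
        _ ≤ _ := by simp only [hD]; gcongr
    have l3 : (ψ n t r - Q r) ^ 2 / r ^ 2 * r ≤ η := by
      have k1 := h2 t ht r hr
      have k2 : (ψ n t r - Q r) ^ 2 ≤ c * η := by
        rw [← sq_abs]
        have := abs_nonneg (ψ n t r - Q r)
        have := k1.trans (min_le_left _ _)
        have := k1.trans (min_le_right _ _)
        nlinarith
      have k3 : (ψ n t r - Q r) ^ 2 / r ^ 2 * r = (ψ n t r - Q r) ^ 2 / r := by field_simp
      rw [k3, div_le_iff₀ hr0]
      refine k2.trans ?_
      rw [mul_comm]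
      gcongr
      exact hr.1
    linarith
  have hmono : ∫ r in c..d, D r ≤ ∫ r in (c / 2)..(2 * d), D r := by
    refine intervalIntegral.integral_mono_interval (by linarith) hcd (by linarith) ?_
      (hDc'.intervalIntegrable_of_Icc (by linarith))
    refine (ae_restrict_iff' measurableSet_Ioc).2 (Eventually.of_forall fun r hr => ?_)
    have r0 : 0 < r := (half_pos hc).trans hr.1
    have r1 : 0 ≤ r - c / 2 := by linarith [hr.1]
    have r2 : 0 ≤ 2 * d - r := by linarith [hr.2]
    simp only [hD, Pi.zero_apply]
    positivity
  rw [intervalIntegral.integral_add, intervalIntegral.integral_const_mul,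
    intervalIntegral.integral_const, smul_eq_mul] at hle
  · have e1 : 2 / (c * d) * ∫ r in c..d, D r ≤ ε / 2 := by
      calc _ ≤ 2 / (c * d) * (c * d / 2 * (ε / 2)) := by
            gcongr
            exact hmono.trans (h1 t ht)
        _ = ε / 2 := by field_simp
    linarith
  · exact ContinuousOn.intervalIntegrable_of_Icc hcd (by fun_prop)
  · exact Continuous.intervalIntegrable (by fun_prop) _ _

end WaveMapSeq

section Endpoint

variable {A : ℝ} {φ : ℝ → ℝ → ℝ}

lemma hasDerivAt_slice_of_hasFDerivWithinAt {D : ℝ × ℝ →L[ℝ] ℝ} {t r : ℝ}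
    (ht : t ∈ Icc (-A) A) (hr : 0 < r)
    (h : HasFDerivWithinAt (fun p : ℝ × ℝ => φ p.1 p.2) D (Icc (-A) A ×ˢ Ioi (0:ℝ)) (t, r)) :
    HasDerivAt (fun ρ => φ t ρ) (D (0, 1)) r := by
  have h1 : HasDerivWithinAt (fun ρ : ℝ => (t, ρ)) ((0 : ℝ), (1 : ℝ)) (Ioi 0) r :=
    ((hasDerivAt_const r t).prodMk (hasDerivAt_id r)).hasDerivWithinAt
  exact (h.comp_hasDerivWithinAt r h1 fun ρ hρ => ⟨ht, hρ⟩).hasDerivAt (Ioi_mem_nhds hr)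

lemma hasDerivWithinAt_time_of_hasFDerivWithinAt {D : ℝ × ℝ →L[ℝ] ℝ} {t r : ℝ} (hr : 0 < r)
    (h : HasFDerivWithinAt (fun p : ℝ × ℝ => φ p.1 p.2) D (Icc (-A) A ×ˢ Ioi (0:ℝ)) (t, r)) :
    HasDerivWithinAt (fun s => φ s r) (D (1, 0)) (Icc (-A) A) t := by
  have h1 : HasDerivWithinAt (fun s : ℝ => (s, r)) ((1 : ℝ), (0 : ℝ)) (Icc (-A) A) t :=
    ((hasDerivAt_id t).prodMk (hasDerivAt_const t r)).hasDerivWithinAt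
  exact h.comp_hasDerivWithinAt t h1 (t := Icc (-A) A ×ˢ Ioi (0:ℝ)) fun s hs => ⟨hs, hr⟩

/-- At the boundary of an interval, the two-sided derivative is either the one-sided derivative or
the default value zero. -/
lemma sq_deriv_le_of_hasDerivWithinAt {f : ℝ → ℝ} {f' t : ℝ} (hA : 0 < A) (ht : t ∈ Icc (-A) A)
    (h : HasDerivWithinAt f f' (Icc (-A) A) t) : deriv f t ^ 2 ≤ f' ^ 2 := by
  by_cases hd : DifferentiableAt ℝ f t
  · rw [(uniqueDiffOn_Icc (by linarith : -A < A) t ht).eq_deriv _ hd.hasDerivAt.hasDerivWithinAt h]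
  · rw [deriv_zero_of_not_differentiableAt hd, zero_pow two_ne_zero]
    exact sq_nonneg _

lemma HLnormSqOn_le_of_forall_Ioo (hA : 0 < A)
    (hφ : ContDiffOn ℝ 2 (fun p : ℝ × ℝ => φ p.1 p.2) (Icc (-A) A ×ˢ Ioi (0:ℝ)))
    {Q Q' : ℝ → ℝ} (hQ : ∀ r, 0 < r → HasDerivAt Q (Q' r) r) (hQ' : ContinuousOn Q' (Ioi 0))
    {c d : ℝ} (hc : 0 < c) {B : ℝ≥0∞}
    (hB : ∀ t ∈ Ioo (-A) A, ∫⁻ r in Icc c d, ENNReal.ofReal ((pdt φ t r ^ 2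
      + (pdr φ t r - Q' r) ^ 2 + (φ t r - Q r) ^ 2 / r ^ 2) * r) ≤ B)
    {t : ℝ} (ht : t ∈ Icc (-A) A) :
    HLnormSqOn (fun r => φ t r - Q r) (pdt φ t) (Icc c d) ≤ B := by
  set Ψ : ℝ × ℝ → ℝ := fun p => φ p.1 p.2 with hΨ
  set S : Set (ℝ × ℝ) := Icc (-A) A ×ˢ Ioi (0:ℝ) with hS
  have hSu : UniqueDiffOn ℝ S := (uniqueDiffOn_Icc (by linarith)).prod (uniqueDiffOn_Ioi 0)
  set D := fderivWithin ℝ Ψ S with hD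
  have hDc : ContinuousOn D S := hφ.continuousOn_fderivWithin hSu (by norm_num)
  have hDd : ∀ p ∈ S, HasFDerivWithinAt Ψ (D p) S p := fun p hp =>
    ((hφ.differentiableOn (by norm_num)) p hp).hasFDerivWithinAt
  have c0 : ContinuousOn Q (Ioi 0) := fun r hr => (hQ r hr).continuousAt.continuousWithinAt
  have hsub : Icc c d ⊆ Ioi 0 := fun x hx => hc.trans_le hx.1
  have hdr : ∀ t ∈ Icc (-A) A, ∀ r, 0 < r → HasDerivAt (fun ρ => φ t ρ) (D (t, r) (0, 1)) r :=
    fun t ht r hr => hasDerivAt_slice_of_hasFDerivWithinAt ht hr (hDd (t, r) ⟨ht, hr⟩)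
  have hdt : ∀ t ∈ Icc (-A) A, ∀ r, 0 < r →
      HasDerivWithinAt (fun s => φ s r) (D (t, r) (1, 0)) (Icc (-A) A) t :=
    fun t ht r hr => hasDerivWithinAt_time_of_hasFDerivWithinAt hr (hDd (t, r) ⟨ht, hr⟩)
  set H : ℝ × ℝ → ℝ := fun p => (D p (1, 0) ^ 2 + (D p (0, 1) - Q' p.2) ^ 2
    + (Ψ p - Q p.2) ^ 2 / p.2 ^ 2) * p.2 with hH
  have hHc : ContinuousOn H S := by
    have k1 : ContinuousOn (fun p : ℝ × ℝ => Q' p.2) S :=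
      hQ'.comp continuousOn_snd fun p hp => hp.2
    have k2 : ContinuousOn (fun p : ℝ × ℝ => Q p.2) S :=
      c0.comp continuousOn_snd fun p hp => hp.2
    have k3 : ContinuousOn (fun p => D p (1, 0)) S := hDc.clm_apply continuousOn_const
    have k4 : ContinuousOn (fun p => D p (0, 1)) S := hDc.clm_apply continuousOn_const
    refine (((k3.pow 2).add ((k4.sub k1).pow 2)).add
      (((hφ.continuousOn.sub k2).pow 2).div (by fun_prop) fun p hp => ?_)).mul continuousOn_snd
    exact pow_ne_zero 2 (ne_of_gt hp.2)
  have hint : ∀ t ∈ Ioo (-A) A, ∫⁻ r in Icc c d, ENNReal.ofReal (H (t, r)) ≤ B := by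
    intro t ht
    refine le_trans (le_of_eq ?_) (hB t ht)
    refine setLIntegral_congr_fun measurableSet_Icc fun r hr => ?_
    have e1 : pdr φ t r = D (t, r) (0, 1) :=
      (hdr t (Ioo_subset_Icc_self ht) r (hsub hr)).deriv
    have e2 : pdt φ t r = D (t, r) (1, 0) :=
      ((hdt t (Ioo_subset_Icc_self ht) r (hsub hr)).hasDerivAt (Icc_mem_nhds ht.1 ht.2)).deriv
    simp only [hH, e1, e2, hΨ]
  set τ : ℕ → ℝ := fun k => t * (1 - 1 / ((k : ℝ) + 1 + 1)) with hτ
  have hτm : ∀ k, τ k ∈ Ioo (-A) A := by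
    intro k
    have hk : 0 < 1 / ((k : ℝ) + 1 + 1) := by positivity
    have hk1 : 1 / ((k : ℝ) + 1 + 1) < 1 := by
      rw [div_lt_one (by positivity)]
      linarith [(Nat.cast_nonneg k : (0 : ℝ) ≤ k)]
    refine abs_lt.1 ?_
    rw [hτ, abs_mul, abs_of_pos (by linarith : 0 < 1 - 1 / ((k : ℝ) + 1 + 1))]
    have := abs_le.2 ht
    nlinarith [abs_nonneg t]
  have hτl : Tendsto τ atTop (𝓝 t) := by
    have h1 : Tendsto (fun k : ℕ => 1 / ((k : ℝ) + 1 + 1)) atTop (𝓝 0) := by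
      have := (tendsto_add_atTop_iff_nat 1).2 (tendsto_one_div_add_atTop_nhds_zero_nat (𝕜 := ℝ))
      simpa using this
    have := (tendsto_const_nhds (x := t)).mul ((tendsto_const_nhds (x := (1 : ℝ))).sub h1)
    rwa [sub_zero, mul_one] at this
  have hfatou : ∫⁻ r in Icc c d, liminf (fun k => ENNReal.ofReal (H (τ k, r))) atTop ≤ B := by
    refine (lintegral_liminf_le' fun k => ?_).trans ?_
    · refine AEMeasurable.ennreal_ofReal (ContinuousOn.aemeasurable ?_ measurableSet_Icc)
      exact hHc.comp (f := fun r : ℝ => (τ k, r)) (by fun_prop)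
        fun r hr => ⟨Ioo_subset_Icc_self (hτm k), hsub hr⟩
    · exact (liminf_le_liminf (Eventually.of_forall fun k => hint _ (hτm k))).trans_eq
        (liminf_const B)
  refine le_trans (setLIntegral_mono' measurableSet_Icc fun r hr => ?_) hfatou
  have hr0 : 0 < r := hsub hr
  have hlim : Tendsto (fun k => ENNReal.ofReal (H (τ k, r))) atTop (𝓝 (ENNReal.ofReal (H (t, r)))) := by
    refine ENNReal.tendsto_ofReal ((hHc (t, r) ⟨ht, hr0⟩).tendsto.comp ?_)
    refine tendsto_nhdsWithin_iff.2 ⟨hτl.prodMk_nhds tendsto_const_nhds, ?_⟩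
    exact Eventually.of_forall fun k => ⟨Ioo_subset_Icc_self (hτm k), hr0⟩
  rw [hlim.liminf_eq]
  refine ENNReal.ofReal_le_ofReal ?_
  have e1 : deriv (fun r => φ t r - Q r) r = D (t, r) (0, 1) - Q' r :=
    ((hdr t ht r hr0).sub (hQ r hr0)).deriv
  have e2 : pdt φ t r ^ 2 ≤ D (t, r) (1, 0) ^ 2 := sq_deriv_le_of_hasDerivWithinAt hA ht
    (hdt t ht r hr0)
  simp only [hH, e1, hΨ]
  gcongr

end Endpoint

section FiniteEnergy

lemma energyOn_static_le {g Q Q' : ℝ → ℝ} (hg : Continuous g)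
    (hQ : ∀ r, 0 < r → HasDerivAt Q (Q' r) r) (hQ' : ContinuousOn Q' (Ioi 0)) {C : ℝ}
    (hC : ∀ a b, 0 < a → a ≤ b → ∫ r in a..b, (Q' r ^ 2 + g (Q r) ^ 2 / r ^ 2) * r ≤ C) :
    energyOn g Q (fun _ => 0) (Ioi 0) ≤ ENNReal.ofReal C := by
  have c0 : ContinuousOn Q (Ioi 0) := fun r hr => (hQ r hr).continuousAt.continuousWithinAt
  set s : ℕ → Set ℝ := fun k => Icc (1 / ((k : ℝ) + 1)) ((k : ℝ) + 1) with hs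
  have hpos : ∀ k : ℕ, 0 < 1 / ((k : ℝ) + 1) := fun k => by positivity
  have hsub : ∀ k, s k ⊆ Ioi 0 := fun k x hx => (hpos k).trans_le hx.1
  have hmono : Monotone s := by
    intro i j hij
    have : (i : ℝ) ≤ j := by exact_mod_cast hij
    exact Icc_subset_Icc (by gcongr) (by gcongr)
  have hU : Ioi (0 : ℝ) = ⋃ k, s k := by
    refine Subset.antisymm (fun r hr => ?_) (iUnion_subset hsub)
    have hr : 0 < r := hr
    obtain ⟨k, hk⟩ := exists_nat_ge (max r (1 / r))
    refine mem_iUnion.2 ⟨k, ?_, ?_⟩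
    · rw [div_le_iff₀ (by positivity)]
      have h1 := (le_max_right _ _).trans hk
      rw [div_le_iff₀ hr] at h1
      nlinarith
    · linarith [(le_max_left _ _).trans hk]
  rw [energyOn, hU, setLIntegral_iUnion_of_directed _ hmono.directed_le]
  refine iSup_le fun k => ?_
  have hk : 1 / ((k : ℝ) + 1) ≤ (k : ℝ) + 1 := by
    have : (0 : ℝ) ≤ k := Nat.cast_nonneg k
    rw [div_le_iff₀ (by positivity)]
    nlinarith
  have e : ∫⁻ r in s k, ENNReal.ofReal (((0 : ℝ) ^ 2 + deriv Q r ^ 2 + g (Q r) ^ 2 / r ^ 2) * r)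
      = ∫⁻ r in s k, ENNReal.ofReal ((Q' r ^ 2 + g (Q r) ^ 2 / r ^ 2) * r) := by
    refine setLIntegral_congr_fun measurableSet_Icc fun r hr => ?_
    simp [(hQ r (hsub k hr)).deriv]
  rw [e, setLIntegral_Icc_ofReal hk]
  · exact ENNReal.ofReal_le_ofReal (hC _ _ (hpos k) hk)
  · have := continuousOn_energy_density hg (fun r hr => hsub k hr) (c0.mono (hsub k))
      (hQ'.mono (hsub k)) (continuousOn_const (c := (0 : ℝ)))
    refine this.congr fun r _ => ?_
    simp only [zero_pow two_ne_zero, zero_add]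
  · intro r hr
    have : 0 < r := hsub k hr
    positivity

end FiniteEnergy

namespace WaveMapSeq

variable {g : ℝ → ℝ} {A E M : ℝ} {ψ : ℕ → ℝ → ℝ → ℝ} {ρ : ℕ → ℝ} {Q Q' : ℝ → ℝ}

lemma integral_limit_energy_le (h : WaveMapSeq g A E M ψ ρ) (hg' : Continuous (deriv g))
    (hconv : ∀ a b, 0 < a → ∀ ε > 0, ∀ᶠ n in atTop, ∀ t ∈ Ioo (-A) A, ∀ r ∈ Icc a b,
      |ψ n t r - Q r| ≤ ε)
    (hQ : ∀ r, 0 < r → HasDerivAt Q (Q' r) r)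
    (hQ' : ∀ r, 0 < r → HasDerivAt (fun r => r * Q' r) (g (Q r) * deriv g (Q r) / r) r)
    (a b : ℝ) (ha : 0 < a) (hab : a ≤ b) :
    ∫ r in a..b, (Q' r ^ 2 + g (Q r) ^ 2 / r ^ 2) * r ≤ 2 * E + 4 := by
  have hE := h.energy_pos
  have hba : 0 ≤ b - a := by linarith
  set η := 1 / (b - a + 1) with hη
  have hη0 : 0 < η := by positivity
  have hηε : η * (b - a) ≤ 1 := by
    rw [hη, div_mul_eq_mul_div, div_le_iff₀ (by positivity)]
    linarith
  obtain ⟨n, h1, h2⟩ := ((h.eventually_integral_le hg' hconv hQ hQ' ha hab one_pos).and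
    (h.eventually_comp_le hconv h.cont a b ha (min 1 (a * η)) (by positivity))).exists
  have h1 := h1 0 h.zero_mem
  have h2 := h2 0 h.zero_mem
  obtain ⟨m, hm⟩ := h.slab n
  have h3 := hm.integral_static_energy_le h.cont hE.le (h.energy_le n) ha hab h.zero_mem
  have hsub : Icc a b ⊆ Ioi 0 := fun x hx => ha.trans_le hx.1
  have c0 : ContinuousOn Q (Icc a b) := fun r hr =>
    (hQ r (hsub hr)).continuousAt.continuousWithinAt
  have c1 : ContinuousOn Q' (Icc a b) := fun r hr => (hasDerivAt_of_mul_id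
    (F := fun r => g (Q r) * deriv g (Q r)) (hsub hr)
      (hQ' r (hsub hr))).continuousAt.continuousWithinAt
  have s0 := (hm.c.slice h.zero_mem).mono hsub
  have s1 := (hm.ct.slice h.zero_mem).mono hsub
  have s2 := (hm.cr.slice h.zero_mem).mono hsub
  have d1 : ContinuousOn (fun r => (Q' r ^ 2 + g (Q r) ^ 2 / r ^ 2) * r) (Icc a b) := by
    simpa using continuousOn_energy_density h.cont (fun r hr => hsub hr) c0 c1
      (continuousOn_const (c := (0 : ℝ)))
  have d2 : ContinuousOn (fun r => (pdr (ψ n) 0 r ^ 2 + g (ψ n 0 r) ^ 2 / r ^ 2) * r)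
      (Icc a b) := by
    simpa using continuousOn_energy_density h.cont (fun r hr => hsub hr) s0 s2
      (continuousOn_const (c := (0 : ℝ)))
  have d3 : ContinuousOn (fun r => (pdt (ψ n) 0 r ^ 2 + (pdr (ψ n) 0 r - Q' r) ^ 2
      + (ψ n 0 r - Q r) ^ 2 / r ^ 2) * r) (Icc a b) :=
    continuousOn_energy_density (g := id) continuous_id (fun r hr => hsub hr) (s0.sub c0)
      (s2.sub c1) s1
  have hle := intervalIntegral.integral_mono_on (μ := volume) hab (d1.intervalIntegrable_of_Icc hab)
    (g := fun r => 2 * ((pdr (ψ n) 0 r ^ 2 + g (ψ n 0 r) ^ 2 / r ^ 2) * r)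
      + 2 * ((pdt (ψ n) 0 r ^ 2 + (pdr (ψ n) 0 r - Q' r) ^ 2
        + (ψ n 0 r - Q r) ^ 2 / r ^ 2) * r) + 2 * η)
    ((((continuousOn_const.mul d2).add (continuousOn_const.mul d3)).add
      continuousOn_const).intervalIntegrable_of_Icc hab) (fun r hr => ?_)
  · rw [intervalIntegral.integral_add, intervalIntegral.integral_add,
      intervalIntegral.integral_const_mul, intervalIntegral.integral_const_mul,
      intervalIntegral.integral_const, smul_eq_mul] at hle
    · linarith
    · exact (continuousOn_const.mul d2).intervalIntegrable_of_Icc hab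
    · exact (continuousOn_const.mul d3).intervalIntegrable_of_Icc hab
    · exact ((continuousOn_const.mul d2).add (continuousOn_const.mul d3)).intervalIntegrable_of_Icc
        hab
    · exact Continuous.intervalIntegrable (by fun_prop) _ _
  · have hr0 : 0 < r := hsub hr
    have k1 := h2 r hr
    have k2 : (g (ψ n 0 r) - g (Q r)) ^ 2 ≤ a * η := by
      rw [← sq_abs]
      have := abs_nonneg (g (ψ n 0 r) - g (Q r))
      have := k1.trans (min_le_left _ _)
      have := k1.trans (min_le_right _ _)
      nlinarith
    have k3 : (g (ψ n 0 r) - g (Q r)) ^ 2 / r ^ 2 * r ≤ η := by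
      have e : (g (ψ n 0 r) - g (Q r)) ^ 2 / r ^ 2 * r = (g (ψ n 0 r) - g (Q r)) ^ 2 / r := by
        field_simp
      rw [e, div_le_iff₀ hr0]
      refine k2.trans ?_
      rw [mul_comm]
      gcongr
      exact hr.1
    have k4 : Q' r ^ 2 * r ≤ 2 * (pdr (ψ n) 0 r ^ 2 * r) + 2 * ((pdr (ψ n) 0 r - Q' r) ^ 2 * r) := by
      nlinarith [mul_nonneg (sq_nonneg (2 * pdr (ψ n) 0 r - Q' r)) hr0.le]
    have k5 : g (Q r) ^ 2 / r ^ 2 * r ≤ 2 * (g (ψ n 0 r) ^ 2 / r ^ 2 * r)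
        + 2 * ((g (ψ n 0 r) - g (Q r)) ^ 2 / r ^ 2 * r) := by
      have : 0 ≤ (2 * g (ψ n 0 r) - g (Q r)) ^ 2 / r ^ 2 * r := by positivity
      have e : 2 * (g (ψ n 0 r) ^ 2 / r ^ 2 * r) + 2 * ((g (ψ n 0 r) - g (Q r)) ^ 2 / r ^ 2 * r)
          = g (Q r) ^ 2 / r ^ 2 * r + (2 * g (ψ n 0 r) - g (Q r)) ^ 2 / r ^ 2 * r := by ring
      linarith
    have k6 : 0 ≤ (pdt (ψ n) 0 r ^ 2 + (ψ n 0 r - Q r) ^ 2 / r ^ 2) * r := by positivity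
    linarith

/-- Convergence in `H × L²` on compact annuli, uniformly over the closed time interval. -/
lemma eventually_HLnormSqOn_le (h : WaveMapSeq g A E M ψ ρ) (hg' : Continuous (deriv g))
    (hconv : ∀ a b, 0 < a → ∀ ε > 0, ∀ᶠ n in atTop, ∀ t ∈ Ioo (-A) A, ∀ r ∈ Icc a b,
      |ψ n t r - Q r| ≤ ε)
    (hQ : ∀ r, 0 < r → HasDerivAt Q (Q' r) r)
    (hQ' : ∀ r, 0 < r → HasDerivAt (fun r => r * Q' r) (g (Q r) * deriv g (Q r) / r) r)
    {c d ε : ℝ} (hc : 0 < c) (hε : 0 < ε) :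
    ∀ᶠ n in atTop, ∀ t ∈ Icc (-A) A,
      HLnormSqOn (fun r => ψ n t r - Q r) (pdt (ψ n) t) (Icc c d) ≤ ENNReal.ofReal ε := by
  by_cases hcd : c ≤ d
  swap
  · simp [HLnormSqOn, Icc_eq_empty hcd]
  filter_upwards [h.eventually_integral_le hg' hconv hQ hQ' hc hcd hε] with n hn t ht
  obtain ⟨m, hm⟩ := h.slab n
  have hsub : Icc c d ⊆ Ioi 0 := fun x hx => hc.trans_le hx.1
  have c0 : ContinuousOn Q (Ioi 0) := fun r hr => (hQ r hr).continuousAt.continuousWithinAt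
  have c1 : ContinuousOn Q' (Ioi 0) := fun r hr => (hasDerivAt_of_mul_id
    (F := fun r => g (Q r) * deriv g (Q r)) hr (hQ' r hr)).continuousAt.continuousWithinAt
  refine HLnormSqOn_le_of_forall_Ioo h.time_pos (h.wave n).1 hQ c1 hc (fun s hs => ?_) ht
  rw [setLIntegral_Icc_ofReal hcd]
  · exact ENNReal.ofReal_le_ofReal (hn s hs)
  · exact continuousOn_energy_density (g := id) continuous_id (fun r hr => hsub hr)
      (((hm.c.slice hs).mono hsub).sub (c0.mono hsub))
      (((hm.cr.slice hs).mono hsub).sub (c1.mono hsub)) ((hm.ct.slice hs).mono hsub)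
  · intro r hr
    have hr0 : 0 < r := hsub hr
    positivity

end WaveMapSeq

lemma strictMono_Gfun {g : ℝ → ℝ} (hg : Continuous g) (hA2 : A2 g) : StrictMono (Gfun g) := by
  have hmono : Monotone (Gfun g) := monotone_of_deriv_nonneg
    (fun x => (hasDerivAt_Gfun hg x).differentiableAt)
    (fun x => by rw [(hasDerivAt_Gfun hg x).deriv]; exact abs_nonneg _)
  refine hmono.strictMono_of_injective ?_
  have key : ∀ x y, x < y → Gfun g x ≠ Gfun g y := by
    intro x y hxy hG
    have hz : ∀ z ∈ Ioo x y, g z = 0 := by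
      intro z hz
      have hev : Gfun g =ᶠ[𝓝 z] fun _ => Gfun g x := by
        filter_upwards [Ioo_mem_nhds hz.1 hz.2] with w hw
        exact le_antisymm ((hmono hw.2.le).trans_eq hG.symm) (hmono hw.1.le)
      exact abs_eq_zero.1
        ((hasDerivAt_Gfun hg z).unique ((hasDerivAt_const z (Gfun g x)).congr_of_eventuallyEq hev))
    set z := (x + y) / 2 with hzdef
    have hzm : z ∈ Ioo x y := ⟨by linarith, by linarith⟩
    obtain ⟨ε, hε, hiso⟩ := hA2 z (hz z hzm)
    set w := z + min (ε / 2) ((y - x) / 4) with hw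
    have hpos : 0 < min (ε / 2) ((y - x) / 4) := lt_min (by linarith) (by linarith)
    have h1 := min_le_left (ε / 2) ((y - x) / 4)
    have h2 := min_le_right (ε / 2) ((y - x) / 4)
    have hwm : w ∈ Ioo x y := ⟨by linarith, by linarith⟩
    have := hiso w (hz w hwm) (by rw [abs_of_nonneg (by linarith)]; linarith)
    linarith
  intro x y hxy
  by_contra hne
  rcases lt_or_gt_of_ne hne with hlt | hlt
  · exact key x y hlt hxy
  · exact key y x hlt hxy.symm

/-- A trajectory of finite action for the potential `g²` converges to a zero of `g`. -/
lemma tendsto_atTop_of_action_bounded {g u v K : ℝ → ℝ} (hg : Continuous g) (hA1 : A1 g)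
    (hA2 : A2 g) (hu : ∀ s, HasDerivAt u (v s) s)
    (hK : ∀ s, HasDerivAt K (v s ^ 2 + g (u s) ^ 2) s) {C M : ℝ} (hKC : ∀ s, |K s| ≤ C)
    (huM : ∀ s, |u s| ≤ M) : ∃ ℓ, Tendsto u atTop (𝓝 ℓ) ∧ g ℓ = 0 := by
  have hGc : Continuous (Gfun g) :=
    continuous_iff_continuousAt.2 fun x => (hasDerivAt_Gfun hg x).continuousAt
  obtain ⟨B, hB⟩ := (isCompact_Icc (a := -M) (b := M)).exists_bound_of_continuousOn
    hGc.continuousOn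
  have hKmono : Monotone K := monotone_of_deriv_nonneg (fun s => (hK s).differentiableAt)
    fun s => by rw [(hK s).deriv]; positivity
  have hKl : Tendsto K atTop (𝓝 (⨆ s, K s)) := tendsto_atTop_ciSup hKmono
    ⟨C, by rintro _ ⟨s, rfl⟩; exact (abs_le.1 (hKC s)).2⟩
  have hGu : ∀ s, HasDerivAt (fun s => K s + Gfun g (u s))
      (v s ^ 2 + g (u s) ^ 2 + |g (u s)| * v s) s := fun s =>
    (hK s).add ((hasDerivAt_Gfun hg (u s)).comp s (hu s))
  have hGmono : Monotone (fun s => K s + Gfun g (u s)) :=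
    monotone_of_deriv_nonneg (fun s => (hGu s).differentiableAt) fun s => by
      rw [(hGu s).deriv, ← sq_abs (g (u s))]
      nlinarith [sq_nonneg (v s + |g (u s)|), sq_nonneg (v s), sq_nonneg |g (u s)|]
  have hGl := tendsto_atTop_ciSup hGmono
    ⟨C + B, by
      rintro _ ⟨s, rfl⟩
      exact add_le_add (abs_le.1 (hKC s)).2 (abs_le.1 (hB (u s) (abs_le.1 (huM s)))).2⟩
  have hlim := hGl.sub hKl
  simp only [add_sub_cancel_left] at hlim
  set e := (strictMono_Gfun hg hA2).orderIsoOfSurjective (Gfun g)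
    (hGc.surjective hA1.1 hA1.2) with he
  have hul : Tendsto u atTop (𝓝 (e.symm ((⨆ s, K s + Gfun g (u s)) - ⨆ s, K s))) :=
    ((e.symm.continuous.tendsto _).comp hlim).congr fun s => e.symm_apply_apply (u s)
  refine ⟨_, hul, ?_⟩
  have hmv : ∀ s, ∃ ξ ∈ Ioo s (s + 1), v ξ ^ 2 + g (u ξ) ^ 2 = (K (s + 1) - K s) := by
    intro s
    obtain ⟨ξ, hξ, hξ'⟩ := exists_hasDerivAt_eq_slope K (fun s => v s ^ 2 + g (u s) ^ 2)
      (by linarith : s < s + 1) (fun s _ => (hK s).continuousAt.continuousWithinAt)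
      (fun s _ => hK s)
    exact ⟨ξ, hξ, by rw [hξ']; simp⟩
  choose ξ hξ hξ' using hmv
  have hξl : Tendsto ξ atTop atTop := tendsto_atTop_mono (fun s => (hξ s).1.le) tendsto_id
  have h1 := (hg.pow 2).continuousAt.tendsto.comp (hul.comp hξl)
  have h2 : Tendsto (fun s => K (s + 1) - K s) atTop (𝓝 0) := by
    have := (hKl.comp (tendsto_atTop_add_const_right atTop (1 : ℝ) tendsto_id)).sub hKl
    simpa using this
  have h3 := le_of_tendsto_of_tendsto' h1 h2 fun s => by
    rw [← hξ' s]
    simp only [Function.comp, Pi.pow_apply]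
    nlinarith [sq_nonneg (v (ξ s))]
  exact pow_eq_zero_iff (two_ne_zero) |>.1 (le_antisymm h3 (sq_nonneg _))

lemma tendsto_atBot_of_action_bounded {g u v K : ℝ → ℝ} (hg : Continuous g) (hA1 : A1 g)
    (hA2 : A2 g) (hu : ∀ s, HasDerivAt u (v s) s)
    (hK : ∀ s, HasDerivAt K (v s ^ 2 + g (u s) ^ 2) s) {C M : ℝ} (hKC : ∀ s, |K s| ≤ C)
    (huM : ∀ s, |u s| ≤ M) : ∃ ℓ, Tendsto u atBot (𝓝 ℓ) ∧ g ℓ = 0 := by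
  obtain ⟨ℓ, hℓ, hg0⟩ := tendsto_atTop_of_action_bounded (u := fun s => u (-s))
    (v := fun s => -v (-s)) (K := fun s => -K (-s)) (C := C) hg hA1 hA2
    (fun s => ((hu (-s)).comp s (hasDerivAt_neg s)).congr_deriv (by ring))
    (fun s => (((hK (-s)).comp s (hasDerivAt_neg s)).neg).congr_deriv (by ring))
    (fun s => by rw [abs_neg]; exact hKC _) (fun s => huM _)
  refine ⟨ℓ, (hℓ.comp tendsto_neg_atBot_atTop).congr fun s => ?_, hg0⟩
  simp

/-- A bounded radial profile of finite energy has limits in the zero set of `g` at `0` and `∞`. -/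
lemma exists_limits_of_finite_energy {g Q Q' : ℝ → ℝ} (hg : Continuous g) (hA1 : A1 g)
    (hA2 : A2 g) (hQ : ∀ r, 0 < r → HasDerivAt Q (Q' r) r) (hQ' : ContinuousOn Q' (Ioi 0))
    {C M : ℝ} (hM : ∀ r, 0 < r → |Q r| ≤ M)
    (hC : ∀ a b, 0 < a → a ≤ b → ∫ r in a..b, (Q' r ^ 2 + g (Q r) ^ 2 / r ^ 2) * r ≤ C) :
    (∃ ℓ, Tendsto Q (𝓝[>] (0:ℝ)) (𝓝 ℓ) ∧ g ℓ = 0) ∧ ∃ ℓ, Tendsto Q atTop (𝓝 ℓ) ∧ g ℓ = 0 := by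
  have c0 : ContinuousOn Q (Ioi 0) := fun r hr => (hQ r hr).continuousAt.continuousWithinAt
  have hcont : ContinuousOn (fun r => (Q' r ^ 2 + g (Q r) ^ 2 / r ^ 2) * r) (Ioi 0) := by
    simpa using continuousOn_energy_density hg (s := Ioi 0) (fun r hr => hr) c0 hQ'
      (continuousOn_const (c := (0 : ℝ)))
  obtain ⟨F, hF⟩ := exists_antideriv_Ioi hcont
  have hnn : ∀ a b, 0 < a → a ≤ b → 0 ≤ F b - F a ∧ F b - F a ≤ C := by
    intro a b ha hab
    have hsub : Icc a b ⊆ Ioi 0 := fun x hx => ha.trans_le hx.1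
    have e := intervalIntegral.integral_eq_sub_of_hasDerivAt (a := a) (b := b) (f := F)
      (fun r hr => hF r (hsub (uIcc_of_le hab ▸ hr)))
      ((hcont.mono hsub).intervalIntegrable_of_Icc hab)
    rw [← e]
    refine ⟨intervalIntegral.integral_nonneg hab fun r hr => ?_, hC a b ha hab⟩
    have : 0 < r := hsub hr
    positivity
  have hu : ∀ s, HasDerivAt (fun s => Q (Real.exp s)) (Q' (Real.exp s) * Real.exp s) s :=
    fun s => (hQ _ (Real.exp_pos s)).comp s (Real.hasDerivAt_exp s)
  have hK : ∀ s, HasDerivAt (fun s => F (Real.exp s) - F 1)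
      ((Q' (Real.exp s) * Real.exp s) ^ 2 + g (Q (Real.exp s)) ^ 2) s := by
    intro s
    refine (((hF _ (Real.exp_pos s)).comp s (Real.hasDerivAt_exp s)).sub_const _).congr_deriv ?_
    field_simp
  have hKC : ∀ s, |F (Real.exp s) - F 1| ≤ C := by
    intro s
    rcases le_total 1 (Real.exp s) with h | h
    · have := hnn 1 _ one_pos h
      rw [abs_of_nonneg this.1]
      exact this.2
    · have := hnn _ 1 (Real.exp_pos s) h
      rw [abs_sub_comm, abs_of_nonneg this.1]
      exact this.2
  have huM : ∀ s, |Q (Real.exp s)| ≤ M := fun s => hM _ (Real.exp_pos s)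
  obtain ⟨ℓ, hℓ, hgℓ⟩ := tendsto_atBot_of_action_bounded hg hA1 hA2 hu hK hKC huM
  obtain ⟨ℓ', hℓ', hgℓ'⟩ := tendsto_atTop_of_action_bounded hg hA1 hA2 hu hK hKC huM
  refine ⟨⟨ℓ, (hℓ.comp Real.tendsto_log_nhdsGT_zero).congr' ?_, hgℓ⟩,
    ⟨ℓ', (hℓ'.comp Real.tendsto_log_atTop).congr' ?_, hgℓ'⟩⟩
  · filter_upwards [self_mem_nhdsWithin] with r hr
    simp [Real.exp_log hr]
  · filter_upwards [eventually_gt_atTop 0] with r hr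
    simp [Real.exp_log hr]

/-- Assembling a harmonic map from a bounded solution of the radial equation of finite energy. -/
lemma exists_harmonicMap {g Q Q' : ℝ → ℝ} (hg : Continuous g) (hg' : Continuous (deriv g))
    (hA1 : A1 g) (hA2 : A2 g) (hQ : ∀ r, 0 < r → HasDerivAt Q (Q' r) r)
    (hQ' : ∀ r, 0 < r → HasDerivAt (fun r => r * Q' r) (g (Q r) * deriv g (Q r) / r) r)
    {C M : ℝ} (hM : ∀ r, 0 < r → |Q r| ≤ M)
    (hC : ∀ a b, 0 < a → a ≤ b → ∫ r in a..b, (Q' r ^ 2 + g (Q r) ^ 2 / r ^ 2) * r ≤ C) :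
    ∃ Qh : HarmonicMap g, Qh.Q = Q := by
  set Q'' : ℝ → ℝ := fun r => (g (Q r) * deriv g (Q r) / r - Q' r) / r with hQ''
  have hd : ∀ r, 0 < r → HasDerivAt Q' (Q'' r) r := fun r hr =>
    hasDerivAt_of_mul_id (F := fun r => g (Q r) * deriv g (Q r)) hr (hQ' r hr)
  have c0 : ContinuousOn Q (Ioi 0) := fun r hr => (hQ r hr).continuousAt.continuousWithinAt
  have c1 : ContinuousOn Q' (Ioi 0) := fun r hr => (hd r hr).continuousAt.continuousWithinAt
  have c2 : ContinuousOn Q'' (Ioi 0) :=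
    ((((hg.mul hg').comp_continuousOn c0).div continuousOn_id fun r hr => ne_of_gt hr).sub c1).div
      continuousOn_id fun r hr => ne_of_gt hr
  have e1 : EqOn (deriv Q) Q' (Ioi 0) := fun r hr => (hQ r hr).deriv
  have e2 : EqOn (deriv Q') Q'' (Ioi 0) := fun r hr => (hd r hr).deriv
  have hC1 : ContDiffOn ℝ 1 Q' (Ioi 0) := by
    rw [show (1 : WithTop ℕ∞) = 0 + 1 by norm_num, contDiffOn_succ_iff_deriv_of_isOpen isOpen_Ioi]
    exact ⟨fun r hr => (hd r hr).differentiableAt.differentiableWithinAt, by simp,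
      contDiffOn_zero.2 (c2.congr e2)⟩
  have hC2 : ContDiffOn ℝ 2 Q (Ioi 0) := by
    rw [show (2 : WithTop ℕ∞) = 1 + 1 by norm_num, contDiffOn_succ_iff_deriv_of_isOpen isOpen_Ioi]
    exact ⟨fun r hr => (hQ r hr).differentiableAt.differentiableWithinAt, by simp, hC1.congr e1⟩
  obtain ⟨⟨ℓ, hℓ, hgℓ⟩, ℓ', hℓ', hgℓ'⟩ := exists_limits_of_finite_energy hg hA1 hA2 hQ c1 hM hC
  refine ⟨⟨Q, ℓ, ℓ', hC2, fun r hr => ?_,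
    (energyOn_static_le hg hQ c1 hC).trans_lt ENNReal.ofReal_lt_top, hℓ, hℓ', hgℓ, hgℓ'⟩, rfl⟩
  have hr0 : 0 < r := hr
  have e3 : deriv (deriv Q) r = Q'' r := by
    rw [(e1.eventuallyEq_of_mem (Ioi_mem_nhds hr0)).deriv_eq, e2 hr]
  rw [e3, e1 hr, hQ'']
  field_simp
  ring

/-- profile at a fixed scale: a sequence of wave maps on `[−A,A]` with
uniformly bounded energy, bounded values at `r = 0`, and vanishing space-time kinetic
energy on expanding balls, converges (up to a subsequence) to a (possibly constant)
harmonic map, strongly in `H × L²` on all compact annuli `[1/R, R]`, uniformly in time. -/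
theorem profile_at_fixed_scale
    (g : ℝ → ℝ) (hg : ContDiff ℝ 3 g) (hA1 : A1 g) (hA2 : A2 g)
    (A E : ℝ) (hA : 0 < A) (hE : 0 < E)
    (ψ : ℕ → ℝ → ℝ → ℝ)
    (hwm : ∀ n, IsWaveMapOn g (ψ n) (Icc (-A) A))
    (hen : ∀ n, ∀ t ∈ Icc (-A) A, energyOn g (ψ n t) (pdt (ψ n) t) (Ioi 0) ≤ ENNReal.ofReal E)
    (ℓ₀ : ℕ → ℝ)
    (hlim0 : ∀ n, ∀ t ∈ Icc (-A) A, Tendsto (ψ n t) (𝓝[>] (0:ℝ)) (𝓝 (ℓ₀ n)))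
    (hbdd : ∃ M : ℝ, ∀ n, |ℓ₀ n| ≤ M)
    (rn : ℕ → ℝ) (hrn : Tendsto rn atTop atTop)
    (hkin : Tendsto (fun n => ∫⁻ t in Icc (-A) A, ∫⁻ r in Ioo 0 (rn n),
        ENNReal.ofReal ((pdt (ψ n) t r)^2 * r)) atTop (𝓝 0)) :
    ∃ σ : ℕ → ℕ, StrictMono σ ∧ ∃ Qh : HarmonicMap g,
      ∀ R : ℝ, 0 < R →
        Tendsto (fun n => ⨆ t ∈ Icc (-A) A,
            HLnormSqOn (fun r => ψ (σ n) t r - Qh.Q r) (pdt (ψ (σ n)) t) (Icc (1/R) R))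
          atTop (𝓝 0) := by
  have hg' : Continuous (deriv g) := hg.continuous_deriv (by norm_num)
  obtain ⟨M, hM⟩ := exists_uniform_bound hg.continuous hA1 hE.le hwm hen hlim0 hbdd
  have hseq : WaveMapSeq g A E M ψ rn :=
    ⟨hg.continuous, hA, hE, hwm, hen, hM, hrn, hkin⟩
  obtain ⟨σ, hσ, Q, hconv⟩ := hseq.exists_limit
  have hsub := hseq.subseq hσ
  obtain ⟨Q', hQ'⟩ := hsub.harmonic_limit hg' hconv
  have hQ := fun r hr => (hQ' r hr).1
  have hQ'' := fun r hr => (hQ' r hr).2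
  obtain ⟨Qh, rfl⟩ := exists_harmonicMap hg.continuous hg' hA1 hA2 hQ hQ''
    (fun r hr => hsub.abs_limit_le hconv hr)
    (hsub.integral_limit_energy_le hg' hconv hQ hQ'')
  refine ⟨σ, hσ, Qh, fun R hR => ENNReal.tendsto_nhds_zero.2 fun ε hε => ?_⟩
  obtain ⟨δ, hδ, hδε⟩ : ∃ δ : ℝ, 0 < δ ∧ ENNReal.ofReal δ ≤ ε := by
    rcases eq_or_ne ε ⊤ with rfl | hε'
    · exact ⟨1, one_pos, le_top⟩
    · exact ⟨ε.toReal, ENNReal.toReal_pos hε.ne' hε', ENNReal.ofReal_toReal_le⟩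
  filter_upwards [hsub.eventually_HLnormSqOn_le hg' hconv hQ hQ'' (c := 1 / R) (d := R)
    (by positivity) hδ] with n hn
  exact iSup₂_le fun t ht => (hn t ht).trans hδε
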